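/- arXiv:1108.2925 — 6 statements merged into one kernel-verified Lean document; each statement's English description precedes it below -/
import Mathlib

section
/- Let A be a real d×n matrix of rank d with no zero columns, L ⊆ ℂ^n its ℂ-row space, L^{−1} ⊆ ℂ^n its reciprocal plane, p ∈ L^{−1}, and J = supp(p) = {j : p_j ≠ 0}. Let T_p be the tangent-cone ideal of L^{−1} at p, namely the ideal of ℂ[x_1,…,x_n] generated by the lowest-degree nonzero homogeneous components of the polynomials f(x + p) as f ranges over the nonzero elements of the vanishing ideal of L^{−1}. Set L_J(p) = the ℂ-row space of the matrix A_J·diag(p_j² : j ∈ J), a linear subspace of ℂ^J, and L_{A/J} = { (u_j)_{j∉J} : u ∈ L with u_j = 0 for all j ∈ J } ⊆ ℂ^{J^c}, with reciprocal plane (L_{A/J})^{−1} ⊆ ℂ^{J^c}. Then T_p equals the vanishing ideal of the variety { x ∈ ℂ^n : (x_j)_{j∈J} ∈ L_J(p) and (x_j)_{j∉J} ∈ (L_{A/J})^{−1} }. In particular, the tangent cone of L^{−1} at p is, up to a linear change of coordinates, the product of a linear space and the reciprocal plane of the contraction A/J. -/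
open MvPolynomial
open scoped Classical

/-- The reciprocal plane `L⁻¹`: the zero locus of the vanishing ideal of
`{u⁻¹ : u ∈ L, all uᵢ ≠ 0}`. -/
def reciprocalPlane {ι : Type*} (L : Submodule ℂ (ι → ℂ)) : Set (ι → ℂ) :=
  {x | ∀ f : MvPolynomial ι ℂ,
    (∀ u : ι → ℂ, u ∈ L → (∀ i, u i ≠ 0) → MvPolynomial.eval (fun i => (u i)⁻¹) f = 0) →
    MvPolynomial.eval x f = 0}

/-- The complex row space of a real matrix. -/
noncomputable def rowSpaceC {d n : ℕ} (A : Matrix (Fin d) (Fin n) ℝ) :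
    Submodule ℂ (Fin n → ℂ) :=
  Submodule.span ℂ (Set.range fun i : Fin d => fun j : Fin n => (A i j : ℂ))

/-- The vanishing ideal of a subset of `ℂ^ι`. -/
noncomputable def vIdeal {ι : Type*} (V : Set (ι → ℂ)) : Ideal (MvPolynomial ι ℂ) where
  carrier := {f | ∀ x ∈ V, MvPolynomial.eval x f = 0}
  add_mem' := by
    intro a b ha hb x hx
    simp [ha x hx, hb x hx]
  zero_mem' := by
    intro x hx
    simp
  smul_mem' := by
    intro c f hf x hx
    simp [smul_eq_mul, hf x hx]

/-- The initial form of a polynomial: its nonzero homogeneous component of minimal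
degree. -/
noncomputable def initForm {ι : Type*} (f : MvPolynomial ι ℂ) : MvPolynomial ι ℂ :=
  homogeneousComponent (sInf {k | homogeneousComponent k f ≠ 0}) f

/-- The tangent-cone ideal of a variety `V` at a point `p`: the ideal generated by the
initial forms of `f(x + p)` for nonzero `f` in the vanishing ideal of `V`. -/
noncomputable def tangentConeIdeal {ι : Type*} (V : Set (ι → ℂ)) (p : ι → ℂ) :
    Ideal (MvPolynomial ι ℂ) :=
  Ideal.span {g | ∃ f ∈ vIdeal V, f ≠ 0 ∧
    g = initForm (aeval (fun i => X i + C (p i)) f)}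

/-- A subspace `L` admits a linear section of the coordinate projection of `L` onto `J`,
written in matrix form. -/
theorem exists_coordinate_section {ι : Type*} [Fintype ι] (L : Submodule ℂ (ι → ℂ)) (J : Finset ι) :
    ∃ S : ι → ι → ℂ, (∀ v : ι → ℂ, (fun i => ∑ j ∈ J, S i j * v j) ∈ L) ∧
      ∀ u ∈ L, ∀ j ∈ J, ∑ k ∈ J, S j k * u k = u j := by
  let ρ : (ι → ℂ) →ₗ[ℂ] (ι → ℂ) :=
    LinearMap.pi fun i => if i ∈ J then LinearMap.proj i else 0
  have hρ : ∀ v i, ρ v i = if i ∈ J then v i else 0 := by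
    intro v i
    by_cases h : i ∈ J <;> simp [ρ, h]
  let f := ρ.domRestrict L
  obtain ⟨g₀, hg₀⟩ := f.rangeRestrict.exists_rightInverse_of_surjective f.range_rangeRestrict
  obtain ⟨g, hg⟩ := LinearMap.exists_extend g₀
  have hfg : ∀ u : L, f (g (f u)) = f u := by
    intro u
    have h1 : g (f u) = g₀ (f.rangeRestrict u) := by
      rw [← hg]; rfl
    have h2 := congrArg Subtype.val (LinearMap.congr_fun hg₀ (f.rangeRestrict u))
    rw [h1]
    exact h2
  have hS : ∀ v i, ∑ j ∈ J, (g (Pi.single j 1) : ι → ℂ) i * v j = (g (ρ v) : ι → ℂ) i := by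
    intro v i
    have h : ρ v = ∑ j ∈ J, v j • Pi.single j (1 : ℂ) := by
      ext k
      simp [hρ, Finset.sum_apply, Pi.single_apply]
    rw [h]
    simp [map_sum, Finset.sum_apply, mul_comm]
  refine ⟨fun i j => (g (Pi.single j 1) : ι → ℂ) i, ?_, ?_⟩
  · intro v
    have : (fun i => ∑ j ∈ J, (g (Pi.single j 1) : ι → ℂ) i * v j) = (g (ρ v) : ι → ℂ) :=
      funext (hS v)
    rw [this]
    exact (g (ρ v)).2
  · intro u hu j hj
    rw [hS]
    have h := congrFun (hfg ⟨u, hu⟩) j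
    simpa [f, hρ, hj] using h

theorem mem_vIdeal_reciprocalPlane {ι : Type*} {L : Submodule ℂ (ι → ℂ)} {f : MvPolynomial ι ℂ} :
    f ∈ vIdeal (reciprocalPlane L) ↔
      ∀ u ∈ L, (∀ i, u i ≠ 0) → eval (fun i => (u i)⁻¹) f = 0 := by
  constructor
  · intro hf u hu hne
    exact hf _ fun g hg => hg u hu hne
  · intro hf x hx
    exact hx f hf

theorem eval_translate {ι : Type*} (p x : ι → ℂ) (f : MvPolynomial ι ℂ) :
    eval x (aeval (fun i => X i + C (p i)) f : MvPolynomial ι ℂ) = eval (x + p) f := by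
  rw [aeval_def, eval_eval₂]
  simp only [algebraMap_eq, eval_add, eval_X, eval_C]
  rw [eval, eval₂Hom, RingHom.coe_mk, MonoidHom.coe_mk]
  congr 1
  ext; simp

theorem eval_smul_of_isHomogeneous {ι : Type*} [Fintype ι] {g : MvPolynomial ι ℂ} {k : ℕ} (hg : g.IsHomogeneous k)
    (t : ℂ) (x : ι → ℂ) : eval (t • x) g = t ^ k * eval x g := by
  rw [eval_eq', eval_eq', Finset.mul_sum]
  refine Finset.sum_congr rfl fun α hα => ?_
  have hαk : ∑ i, α i = k := by
    rw [← Finsupp.degree_eq_sum]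
    exact not_imp_comm.mp hg.coeff_eq_zero (mem_support_iff.mp hα)
  simp only [Pi.smul_apply, smul_eq_mul, mul_pow, Finset.prod_mul_distrib,
    Finset.prod_pow_eq_pow_sum, hαk]
  ring

theorem initForm_eq_of_coeff {ι : Type*} {F g : MvPolynomial ι ℂ} {k : ℕ} (hg : g.IsHomogeneous k)
    (hg0 : g ≠ 0) (h : ∀ β : ι →₀ ℕ, β.degree ≤ k → coeff β F = coeff β g) :
    initForm F = g := by
  have hk : homogeneousComponent k F = g := by
    ext β
    rw [coeff_homogeneousComponent]
    split_ifs with hβ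
    · exact h β hβ.le
    · exact (hg.coeff_eq_zero hβ).symm
  have hlt : ∀ m < k, homogeneousComponent m F = 0 := by
    intro m hm
    ext β
    rw [coeff_homogeneousComponent]
    split_ifs with hβ
    · rw [h β (by omega), coeff_zero, hg.coeff_eq_zero (by omega)]
    · simp
  have hinf : sInf {m | homogeneousComponent m F ≠ 0} = k := by
    apply le_antisymm
    · exact Nat.sInf_le (by simpa [hk] using hg0)
    · refine le_csInf ⟨k, by simpa [hk] using hg0⟩ fun m hm => ?_
      by_contra hlt'
      exact hm (hlt m (by omega))
  rw [initForm, hinf, hk]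

/-- Substituting `Xᵢ Eᵢ` with all `Eᵢ(0) = c` into a form only rescales its initial form. -/
theorem initForm_mul_aeval {ι : Type*} [Fintype ι] {g H : MvPolynomial ι ℂ} {k : ℕ} (hg : g.IsHomogeneous k)
    (hg0 : g ≠ 0) (E : ι → MvPolynomial ι ℂ) {c : ℂ} (hE : ∀ i, eval 0 (E i) = c)
    (hc : c ≠ 0) (hH : eval 0 H ≠ 0) :
    initForm (H * aeval (fun i => X i * E i) g) = C (eval 0 H * c ^ k) * g := by
  have hne : C (eval 0 H * c ^ k) * g ≠ 0 :=
    mul_ne_zero (C_ne_zero.mpr (mul_ne_zero hH (pow_ne_zero _ hc))) hg0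
  refine initForm_eq_of_coeff (k := k) ?_ hne ?_
  · simpa using (isHomogeneous_C ι (eval 0 H * c ^ k)).mul hg
  intro β hβ
  rw [aeval_def, eval₂_eq', Finset.mul_sum, coeff_sum, coeff_C_mul]
  have key : ∀ α ∈ g.support, coeff β (H * (algebraMap ℂ (MvPolynomial ι ℂ) (coeff α g) *
      ∏ i, (X i * E i) ^ α i)) = if α = β then eval 0 H * c ^ k * coeff β g else 0 := by
    intro α hα
    have hαk : α.degree = k := not_imp_comm.mp hg.coeff_eq_zero (mem_support_iff.mp hα)
    have e : H * (algebraMap ℂ (MvPolynomial ι ℂ) (coeff α g) * ∏ i, (X i * E i) ^ α i) =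
        monomial α (coeff α g) * (H * ∏ i, E i ^ α i) := by
      rw [monomial_eq, Finsupp.prod_fintype _ _ (by simp)]
      simp only [mul_pow, Finset.prod_mul_distrib, algebraMap_eq]
      ring
    rw [e, coeff_monomial_mul']
    by_cases hab : α = β
    · subst hab
      have hs : ∑ i, α i = k := by rw [← hαk, Finsupp.degree_eq_sum]
      rw [if_pos le_rfl, if_pos rfl, tsub_self, ← constantCoeff_eq, ← eval_zero]
      simp only [map_mul, map_prod, map_pow, hE, Finset.prod_pow_eq_pow_sum, hs]
      ring
    · rw [if_neg hab, if_neg]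
      intro hle
      obtain ⟨δ, rfl⟩ := exists_add_of_le hle
      rw [map_add] at hβ
      have : δ.degree = 0 := by omega
      rw [Finsupp.degree_eq_zero_iff] at this
      exact hab (by simp [this])
  rw [Finset.sum_congr rfl key, Finset.sum_ite_eq']
  split_ifs with hs
  · rfl
  · rw [notMem_support_iff.mp hs, mul_zero]

/-- If `f` vanishes along a curve `p + t γ(t)`, then its initial form at `p` vanishes
at `γ(0)`. -/
theorem eval_initForm_eq_zero {ι : Type*} [Fintype ι] {f : MvPolynomial ι ℂ} {p : ι → ℂ} {γ : ℂ → ι → ℂ}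
    (hγ : ContinuousAt γ 0)
    (hf : ∀ᶠ t in nhdsWithin (0 : ℂ) {0}ᶜ, eval (t • γ t + p) f = 0) :
    eval (γ 0) (initForm (aeval (fun i => X i + C (p i)) f)) = 0 := by
  set F : MvPolynomial ι ℂ := aeval (fun i => X i + C (p i)) f with hF
  rw [initForm]
  set m := sInf {k | homogeneousComponent k F ≠ 0} with hm
  let G : ℂ → ℂ := fun t => ∑ k ∈ Finset.range (F.totalDegree + m + 1),
    if k < m then 0 else t ^ (k - m) * eval (γ t) (homogeneousComponent k F)
  have hG : ContinuousAt G 0 := by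
    refine tendsto_finsetSum _ fun k _ => ?_
    split_ifs
    · exact tendsto_const_nhds
    · exact ((continuous_pow _).continuousAt).mul
        ((MvPolynomial.continuous_eval (homogeneousComponent k F)).continuousAt.comp hγ)
  have hsum : F = ∑ k ∈ Finset.range (F.totalDegree + m + 1), homogeneousComponent k F := by
    conv_lhs => rw [← sum_homogeneousComponent F]
    refine Finset.sum_subset (Finset.range_mono (by omega)) fun k _ hk => ?_
    exact homogeneousComponent_eq_zero _ _ (by simpa using hk)
  have hGF : ∀ t, t ^ m * G t = eval (t • γ t) F := by
    intro t
    rw [hsum, map_sum, Finset.mul_sum]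
    refine Finset.sum_congr rfl fun k _ => ?_
    split_ifs with hk
    · have : homogeneousComponent k F = 0 := by
        by_contra hne
        exact Nat.notMem_of_lt_sInf hk hne
      simp [this]
    · rw [← mul_assoc, ← pow_add, Nat.add_sub_cancel' (by omega)]
      rw [eval_smul_of_isHomogeneous (homogeneousComponent_isHomogeneous k F)]
  have hG0 : G 0 = 0 := by
    refine tendsto_nhds_unique (hG.mono_left (nhdsWithin_le_nhds (s := {0}ᶜ))) ?_
    refine tendsto_const_nhds.congr' ?_
    filter_upwards [hf, self_mem_nhdsWithin] with t ht ht0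
    have h := hGF t
    rw [hF, eval_translate, ht] at h
    exact ((mul_eq_zero.mp h).resolve_left (pow_ne_zero _ ht0)).symm
  have : G 0 = eval (γ 0) (homogeneousComponent m F) := by
    simp only [G]
    rw [Finset.sum_eq_single m]
    · simp
    · intro k _ hk
      split_ifs with hkm
      · rfl
      · rw [zero_pow (by omega), zero_mul]
    · intro h; simp at h
  rw [← this, hG0]

/-- The points of the expected tangent cone at `p` whose coordinates off the support of `p`
are all nonzero. -/
def tangentConePoints {ι : Type*} (L : Submodule ℂ (ι → ℂ)) (p : ι → ℂ) : Set (ι → ℂ) :=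
  {y | ∃ a ∈ L, ∃ w ∈ L, ∀ j, (p j ≠ 0 → w j = 0 ∧ y j = a j * p j ^ 2) ∧
    (p j = 0 → w j ≠ 0 ∧ y j = (w j)⁻¹)}

theorem smul_mem_tangentConePoints {ι : Type*} {L : Submodule ℂ (ι → ℂ)} {p y : ι → ℂ}
    (hy : y ∈ tangentConePoints L p) {t : ℂ} (ht : t ≠ 0) :
    t • y ∈ tangentConePoints L p := by
  obtain ⟨a, ha, w, hw, h⟩ := hy
  refine ⟨t • a, L.smul_mem t ha, t⁻¹ • w, L.smul_mem _ hw, fun j => ⟨fun hj => ?_, fun hj => ?_⟩⟩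
  · obtain ⟨h1, h2⟩ := (h j).1 hj
    simp [h1, h2, mul_assoc]
  · obtain ⟨h1, h2⟩ := (h j).2 hj
    simp [h1, h2, ht, mul_comm]

/-- The vanishing ideal of a set stable under nonzero scalars is homogeneous. -/
theorem homogeneousComponent_mem_vIdeal {ι : Type*} [Fintype ι] {T : Set (ι → ℂ)}
    (hT : ∀ y ∈ T, ∀ t : ℂ, t ≠ 0 → t • y ∈ T) {g : MvPolynomial ι ℂ} (hg : g ∈ vIdeal T)
    (k : ℕ) : homogeneousComponent k g ∈ vIdeal T := by
  intro y hy
  by_cases hk : g.totalDegree < k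
  · rw [homogeneousComponent_eq_zero _ _ hk, map_zero]
  let P : Polynomial ℂ := ∑ m ∈ Finset.range (g.totalDegree + 1),
    Polynomial.monomial m (eval y (homogeneousComponent m g))
  have hP : ∀ t : ℂ, t ≠ 0 → P.IsRoot t := by
    intro t ht
    have h : eval (t • y) g = 0 := hg _ (hT y hy t ht)
    rw [← sum_homogeneousComponent g, map_sum] at h
    rw [Polynomial.IsRoot, Polynomial.eval_finsetSum, ← h]
    refine Finset.sum_congr rfl fun m _ => ?_
    rw [eval_smul_of_isHomogeneous (homogeneousComponent_isHomogeneous m g),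
      Polynomial.eval_monomial, mul_comm]
  have hP0 : P = 0 := by
    refine Polynomial.eq_zero_of_infinite_isRoot P (Set.Infinite.mono (s := {0}ᶜ) hP ?_)
    exact (Set.finite_singleton (0 : ℂ)).infinite_compl
  have h := congrArg (fun q => Polynomial.coeff q k) hP0
  simp only [P, Polynomial.finsetSum_coeff, Polynomial.coeff_monomial, Polynomial.coeff_zero] at h
  rwa [Finset.sum_ite_eq', if_pos (by simp; omega)] at h

/-- The polynomial `(∏ⱼ xⱼ) (1 - xᵢ ∑ⱼ Sᵢⱼ xⱼ⁻¹)`, with `j` ranging over `J`. -/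
noncomputable def sectionDenom {ι : Type*} (S : ι → ι → ℂ) (J : Finset ι) (i : ι) : MvPolynomial ι ℂ :=
  ∏ k ∈ J, X k - X i * ∑ j ∈ J, C (S i j) * ∏ k ∈ J.erase j, X k

theorem eval_sectionDenom {ι : Type*} (S : ι → ι → ℂ) {J : Finset ι} (i : ι) {x : ι → ℂ}
    (hx : ∀ j ∈ J, x j ≠ 0) :
    eval x (sectionDenom S J i) = (∏ k ∈ J, x k) * (1 - x i * ∑ j ∈ J, S i j * (x j)⁻¹) := by
  simp only [sectionDenom, map_sub, map_mul, map_prod, map_sum, eval_X, eval_C]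
  rw [mul_sub, mul_one, mul_left_comm, Finset.mul_sum (s := J) (a := ∏ k ∈ J, x k)]
  congr 2
  refine Finset.sum_congr rfl fun j hj => ?_
  rw [← Finset.mul_prod_erase J x hj]
  field_simp [hx j hj]

theorem section_inv_of_mem_reciprocalPlane {ι : Type*} {L : Submodule ℂ (ι → ℂ)} {p : ι → ℂ}
    (hp : p ∈ reciprocalPlane L) {J : Finset ι} (hJ : ∀ j ∈ J, p j ≠ 0) {S : ι → ι → ℂ}
    (hS : ∀ u ∈ L, ∀ j ∈ J, ∑ k ∈ J, S j k * u k = u j) {j : ι} (hj : j ∈ J) :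
    ∑ k ∈ J, S j k * (p k)⁻¹ = (p j)⁻¹ := by
  have h : sectionDenom S J j ∈ vIdeal (reciprocalPlane L) := by
    rw [mem_vIdeal_reciprocalPlane]
    intro u hu hne
    rw [eval_sectionDenom S j fun k _ => inv_ne_zero (hne k)]
    simp [hS u hu j hj, hne j]
  have h0 := h p hp
  rw [eval_sectionDenom S j hJ] at h0
  have h1 := (mul_eq_zero.mp h0).resolve_left (Finset.prod_ne_zero_iff.mpr hJ)
  exact eq_inv_of_mul_eq_one_right (sub_eq_zero.mp h1).symm

theorem tangentConeIdeal_le {ι : Type*} [Fintype ι] {L : Submodule ℂ (ι → ℂ)} {p : ι → ℂ}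
    (hp : p ∈ reciprocalPlane L) :
    tangentConeIdeal (reciprocalPlane L) p ≤ vIdeal (tangentConePoints L p) := by
  rw [tangentConeIdeal, Ideal.span_le]
  rintro _ ⟨f, hf, -, rfl⟩ y ⟨a, ha, w, hw, hy⟩
  obtain ⟨S, hSL, hS⟩ := exists_coordinate_section L (Finset.univ.filter fun j => p j ≠ 0)
  set J := Finset.univ.filter fun j => p j ≠ 0 with hJ
  set c : ι → ℂ := fun i => ∑ j ∈ J, S i j * (p j)⁻¹ with hc
  have hcL : c ∈ L := hSL fun j => (p j)⁻¹
  have hcp : ∀ j, p j ≠ 0 → c j = (p j)⁻¹ := fun j hj =>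
    section_inv_of_mem_reciprocalPlane hp (by simp [hJ]) hS (by simp [hJ, hj])
  let γ : ℂ → ι → ℂ := fun t i =>
    if p i = 0 then (w i + t * (c i - t * a i))⁻¹ else a i * p i ^ 2 / (1 - t * a i * p i)
  have hγ0 : γ 0 = y := by
    ext i
    by_cases hi : p i = 0
    · simp [γ, hi, ((hy i).2 hi).2]
    · simp [γ, hi, ((hy i).1 hi).2]
  have hγ : ContinuousAt γ 0 := by
    refine continuousAt_pi.mpr fun i => ?_
    by_cases hi : p i = 0
    · simp only [γ, hi, if_true]
      refine ContinuousAt.inv₀ (by fun_prop) ?_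
      simpa using ((hy i).2 hi).1
    · simp only [γ, hi, if_false]
      exact ContinuousAt.div (by fun_prop) (by fun_prop) (by simp)
  rw [← hγ0]
  refine eval_initForm_eq_zero hγ ?_
  have hev1 : ∀ᶠ t in nhds (0 : ℂ), ∀ i, p i = 0 → w i + t * (c i - t * a i) ≠ 0 := by
    refine Filter.eventually_all.mpr fun i => ?_
    by_cases hi : p i = 0
    · have hcont : ContinuousAt (fun t : ℂ => w i + t * (c i - t * a i)) 0 := by fun_prop
      filter_upwards [hcont.eventually_ne (by simpa using ((hy i).2 hi).1)] with t ht _ using ht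
    · simp [hi]
  have hev2 : ∀ᶠ t in nhds (0 : ℂ), ∀ i, 1 - t * a i * p i ≠ 0 := by
    refine Filter.eventually_all.mpr fun i => ?_
    have hcont : ContinuousAt (fun t : ℂ => 1 - t * a i * p i) 0 := by fun_prop
    exact hcont.eventually_ne (by simp)
  filter_upwards [nhdsWithin_le_nhds hev1, nhdsWithin_le_nhds hev2, self_mem_nhdsWithin]
    with t h1 h2 ht
  have ht : t ≠ 0 := ht
  have huL : c - t • a + t⁻¹ • w ∈ L :=
    L.add_mem (L.sub_mem hcL (L.smul_mem _ ha)) (L.smul_mem _ hw)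
  have hmul : ∀ i, (c - t • a + t⁻¹ • w) i * (t • γ t + p) i = 1 := by
    intro i
    by_cases hi : p i = 0
    · have := h1 i hi
      simp only [Pi.add_apply, Pi.sub_apply, Pi.smul_apply, smul_eq_mul, γ, hi, if_true]
      field_simp
      ring
    · have := h2 i
      simp only [Pi.add_apply, Pi.sub_apply, Pi.smul_apply, smul_eq_mul, γ, hi, if_false,
        hcp i hi, ((hy i).1 hi).1]
      obtain ⟨q, hq⟩ : ∃ q, q = 1 - t * a i * p i := ⟨_, rfl⟩
      rw [← hq] at this ⊢
      field_simp
      rw [hq]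
      ring
  have h := mem_vIdeal_reciprocalPlane.mp hf _ huL fun i => left_ne_zero_of_mul_eq_one (hmul i)
  have heq : (fun i => ((c - t • a + t⁻¹ • w) i)⁻¹) = t • γ t + p :=
    funext fun i => inv_eq_of_mul_eq_one_right (hmul i)
  rwa [heq] at h

theorem le_tangentConeIdeal {ι : Type*} [Fintype ι] {L : Submodule ℂ (ι → ℂ)} {p : ι → ℂ}
    (hp : p ∈ reciprocalPlane L) :
    vIdeal (tangentConePoints L p) ≤ tangentConeIdeal (reciprocalPlane L) p := by
  intro g' hg'
  rw [← sum_homogeneousComponent g']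
  refine Ideal.sum_mem _ fun k _ => ?_
  have hg := homogeneousComponent_mem_vIdeal
    (fun y hy t ht => smul_mem_tangentConePoints hy ht) hg' k
  have hgk := homogeneousComponent_isHomogeneous k g'
  set g := homogeneousComponent k g'
  by_cases hg0 : g = 0
  · rw [hg0]; exact Ideal.zero_mem _
  obtain ⟨S, hSL, hS⟩ := exists_coordinate_section L (Finset.univ.filter fun j => p j ≠ 0)
  set J := Finset.univ.filter fun j => p j ≠ 0 with hJ
  have hJp : ∀ j, j ∈ J ↔ p j ≠ 0 := by simp [hJ]
  set c : ι → ℂ := fun i => ∑ j ∈ J, S i j * (p j)⁻¹ with hc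
  have hcL : c ∈ L := hSL fun j => (p j)⁻¹
  have hcp : ∀ j ∈ J, c j = (p j)⁻¹ := fun j hj =>
    section_inv_of_mem_reciprocalPlane hp (fun j => (hJp j).1) hS hj
  let D : MvPolynomial ι ℂ := ∏ i ∈ Jᶜ, sectionDenom S J i
  let R : ι → MvPolynomial ι ℂ := fun i =>
    if i ∈ J then C (p i) * (∏ k ∈ J.erase i, X k) * D
    else (∏ k ∈ J, X k) ^ 2 * ∏ k ∈ Jᶜ.erase i, sectionDenom S J k
  let Q : ι → MvPolynomial ι ℂ := fun i => (X i - C (p i)) * R i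
  let τ : MvPolynomial ι ℂ →ₐ[ℂ] MvPolynomial ι ℂ := aeval fun i => X i + C (p i)
  have hτ0 : ∀ q, eval 0 (τ q) = eval p q := fun q => by
    rw [eval_translate, zero_add]
  have hNp : ∏ k ∈ J, p k ≠ 0 := Finset.prod_ne_zero_iff.mpr fun j => (hJp j).1
  have hdp : ∀ i ∈ Jᶜ, eval p (sectionDenom S J i) = ∏ k ∈ J, p k := by
    intro i hi
    rw [eval_sectionDenom S i fun j => (hJp j).1]
    have : p i = 0 := by simpa [hJp] using hi
    simp [this]
  have hDp : eval p D ≠ 0 := by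
    simp only [D, map_prod]
    exact Finset.prod_ne_zero_iff.mpr fun i hi => by rwa [hdp i hi]
  have hRp : ∀ i, eval 0 (τ (R i)) = (∏ k ∈ J, p k) * eval p D := by
    intro i
    rw [hτ0]
    by_cases hi : i ∈ J
    · simp only [R, hi, if_true, map_mul, map_prod, eval_X, eval_C]
      rw [Finset.mul_prod_erase J p hi]
    · have hi' : i ∈ Jᶜ := by simpa using hi
      simp only [R, hi, if_false, D, map_mul, map_prod, eval_X, map_pow]
      rw [← Finset.mul_prod_erase Jᶜ _ hi', hdp i hi']
      ring
  have hmem : D * aeval Q g ∈ vIdeal (reciprocalPlane L) := by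
    rw [mem_vIdeal_reciprocalPlane]
    intro u hu hne
    set x : ι → ℂ := fun i => (u i)⁻¹ with hx
    have hd : ∀ i, eval x (sectionDenom S J i) =
        (∏ k ∈ J, x k) * ((u i - ∑ j ∈ J, S i j * u j) * x i) := by
      intro i
      rw [eval_sectionDenom S i fun j _ => inv_ne_zero (hne j)]
      simp only [hx, inv_inv]
      field_simp [hne i]
    rw [map_mul]
    by_cases hD : eval x D = 0
    · rw [hD, zero_mul]
    set w : ι → ℂ := fun i => u i - ∑ j ∈ J, S i j * u j with hw
    have hwL : w ∈ L := L.sub_mem hu (hSL u)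
    have hw0 : ∀ i ∈ Jᶜ, w i ≠ 0 := by
      intro i hi h0
      apply hD
      simp only [D, map_prod]
      refine Finset.prod_eq_zero hi ?_
      rw [hd i]
      simp only [hw] at h0
      rw [h0]; simp
    let y : ι → ℂ := fun i => if i ∈ J then (c - u) i * p i ^ 2 else (w i)⁻¹
    have hy : y ∈ tangentConePoints L p := by
      refine ⟨c - u, L.sub_mem hcL hu, w, hwL, fun j => ⟨fun hj => ?_, fun hj => ?_⟩⟩
      · have hj' := (hJp j).2 hj
        exact ⟨by simp [hw, hS u hu j hj'], by simp [y, hj']⟩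
      · have hj' : j ∉ J := by simp [hJp, hj]
        exact ⟨hw0 j (by simpa using hj'), by simp [y, hj']⟩
    have hQ : (fun i => eval x (Q i)) = ((∏ k ∈ J, x k) * eval x D) • y := by
      ext i
      by_cases hi : i ∈ J
      · have hpi := (hJp i).1 hi
        have hui := hne i
        simp only [Q, R, y, hi, if_true, map_mul, map_prod, map_sub, eval_X, eval_C,
          Pi.smul_apply, smul_eq_mul, Pi.sub_apply, hcp i hi]
        rw [← Finset.mul_prod_erase J x hi]
        simp only [hx]
        field_simp
      · have hi' : i ∈ Jᶜ := by simpa using hi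
        have hpi : p i = 0 := by simpa [hJp] using hi
        have hwi := hw0 i hi'
        simp only [Q, R, y, hi, if_false, D, map_mul, map_prod, map_sub, eval_X, eval_C, map_pow,
          Pi.smul_apply, smul_eq_mul, hpi, sub_zero]
        rw [← Finset.mul_prod_erase Jᶜ _ hi', hd i]
        change _ = _ * (_ * (w i * x i) * _) * (w i)⁻¹
        field_simp
    have hev : eval x (aeval Q g) = eval (fun i => eval x (Q i)) g := by
      rw [aeval_def, eval_eval₂, eval, eval₂Hom, RingHom.coe_mk, MonoidHom.coe_mk]
      congr 1
      ext; simp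
    rw [hev, hQ, eval_smul_of_isHomogeneous hgk, hg y hy, mul_zero, mul_zero]
  have hτf : τ (D * aeval Q g) = τ D * aeval (fun i => X i * τ (R i)) g := by
    rw [map_mul, ← AlgHom.comp_apply, comp_aeval]
    congr 3
    ext1 i
    simp [Q, τ]
  have hc0 : (∏ k ∈ J, p k) * eval p D ≠ 0 := mul_ne_zero hNp hDp
  have hin := initForm_mul_aeval (H := τ D) hgk hg0 (fun i => τ (R i)) hRp hc0
    (by rwa [hτ0])
  rw [← hτf] at hin
  set e : ℂ := eval 0 (τ D) * ((∏ k ∈ J, p k) * eval p D) ^ k with he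
  have he0 : e ≠ 0 := mul_ne_zero (by rwa [hτ0]) (pow_ne_zero _ hc0)
  have hge : g = C e⁻¹ * initForm (τ (D * aeval Q g)) := by
    rw [hin, ← mul_assoc, ← C_mul, inv_mul_cancel₀ he0, C_1, one_mul]
  have hf0 : D * aeval Q g ≠ 0 := by
    intro h0
    rw [h0, map_zero] at hge
    exact hg0 (by rw [hge]; simp [initForm])
  rw [hge]
  exact Ideal.mul_mem_left _ _ (Ideal.subset_span ⟨_, hmem, hf0, rfl⟩)

theorem vIdeal_tangentConePoints {ι : Type*} (L : Submodule ℂ (ι → ℂ)) (p : ι → ℂ)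
    {W : Submodule ℂ ({j : ι // p j ≠ 0} → ℂ)}
    (hW : W = L.map (LinearMap.pi fun j : {j : ι // p j ≠ 0} => p j.1 ^ 2 • LinearMap.proj j.1)) :
    vIdeal (tangentConePoints L p) = vIdeal {x : ι → ℂ |
      (fun j : {j : ι // p j ≠ 0} => x j.1) ∈ W ∧
        (fun j : {j : ι // p j = 0} => x j.1) ∈
          reciprocalPlane (Submodule.map
            (LinearMap.funLeft ℂ ℂ (fun j : {j : ι // p j = 0} => j.1))
            (L ⊓ LinearMap.ker
              (LinearMap.funLeft ℂ ℂ (fun j : {j : ι // p j ≠ 0} => j.1))))} := by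
  subst hW
  ext g
  constructor
  · rintro hg x ⟨⟨a, ha, hax⟩, hx⟩
    let h : MvPolynomial {j : ι // p j = 0} ℂ :=
      aeval (fun i => if hi : p i = 0 then X ⟨i, hi⟩ else C (x i)) g
    have hh : ∀ z, eval z h = eval (fun i => if hi : p i = 0 then z ⟨i, hi⟩ else x i) g := by
      intro z
      simp only [h]
      rw [aeval_def, eval_eval₂, eval, eval₂Hom, RingHom.coe_mk, MonoidHom.coe_mk]
      congr 1
      · ext; simp
      · ext i
        split_ifs <;> simp
    have h0 := hx h ?_
    · rw [hh] at h0
      simpa using h0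
    · rintro _ ⟨w, ⟨hw, hwk⟩, rfl⟩ hne
      rw [hh]
      refine hg _ ⟨a, ha, w, hw, fun j => ⟨fun hj => ⟨congrFun hwk ⟨j, hj⟩, ?_⟩,
        fun hj => ⟨hne ⟨j, hj⟩, ?_⟩⟩⟩
      · have := congrFun hax ⟨j, hj⟩
        simp only [LinearMap.pi_apply, LinearMap.smul_apply, LinearMap.proj_apply,
          smul_eq_mul] at this
        simp [hj, ← this, mul_comm]
      · simp [hj, LinearMap.funLeft_apply]
  · rintro hg y ⟨a, ha, w, hw, h⟩
    refine hg y ⟨⟨a, ha, ?_⟩, fun f hf => ?_⟩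
    · ext j
      simp [((h j.1).1 j.2).2, mul_comm]
    · have := hf (fun j => w j.1) ⟨w, ⟨hw, ?_⟩, rfl⟩ fun j => ((h j.1).2 j.2).1
      · have hy : (fun j : {j : ι // p j = 0} => y j.1) = fun j => (w j.1)⁻¹ :=
          funext fun j => ((h j.1).2 j.2).2
        rw [hy]
        exact this
      · rw [SetLike.mem_coe, LinearMap.mem_ker]
        ext j
        exact ((h j.1).1 j.2).1

/-- The tangent cone of the reciprocal plane `L⁻¹` at a point `p` with support `J` is the
product of the linear space `rowspan(A_J diag(p_J)²)` and the reciprocal plane of the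
contraction `L_{A/J}`. -/
theorem stmt_12 {d n : ℕ} (A : Matrix (Fin d) (Fin n) ℝ)
    (hrank : A.rank = d) (hcol : ∀ j : Fin n, (fun i => A i j) ≠ 0)
    (p : Fin n → ℂ) (hp : p ∈ reciprocalPlane (rowSpaceC A)) :
    tangentConeIdeal (reciprocalPlane (rowSpaceC A)) p =
      vIdeal {x : Fin n → ℂ |
        (fun j : {j : Fin n // p j ≠ 0} => x j.1) ∈
          Submodule.span ℂ (Set.range fun i : Fin d =>
            fun j : {j : Fin n // p j ≠ 0} => (A i j.1 : ℂ) * p j.1 ^ 2) ∧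
        (fun j : {j : Fin n // p j = 0} => x j.1) ∈
          reciprocalPlane (Submodule.map
            (LinearMap.funLeft ℂ ℂ (fun j : {j : Fin n // p j = 0} => j.1))
            (rowSpaceC A ⊓ LinearMap.ker
              (LinearMap.funLeft ℂ ℂ (fun j : {j : Fin n // p j ≠ 0} => j.1))))} := by
  rw [← vIdeal_tangentConePoints (rowSpaceC A) p ?_]
  · exact le_antisymm (tangentConeIdeal_le hp) (le_tangentConeIdeal hp)
  · rw [rowSpaceC, Submodule.map_span, ← Set.range_comp]
    congr 2
    ext i j
    simp [mul_comm]
end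

section
/- Let A be a real d×n matrix of rank d with no zero columns, L ⊆ ℂ^n its ℂ-row space, and L^{−1} ⊆ ℂ^n its reciprocal plane. Let p ∈ L^{−1} have all coordinates nonzero. Then the tangent-cone ideal of L^{−1} at p — the ideal generated by the lowest-degree nonzero homogeneous components of f(x + p) for nonzero f in the vanishing ideal of L^{−1} — equals the vanishing ideal of the d-dimensional linear subspace of ℂ^n spanned by the rows of A·diag(p_1²,…,p_n²). In particular, at every point of the torus the tangent cone of L^{−1} is the linear space rowspan(A·diag(p)²). -/
open MvPolynomial
open scoped Classical

theorem mem_reciprocalPlane_inv {ι : Type*} {L : Submodule ℂ (ι → ℂ)} {u : ι → ℂ} (hu : u ∈ L)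
    (hu0 : ∀ i, u i ≠ 0) : (fun i => (u i)⁻¹) ∈ reciprocalPlane L :=
  fun _ hf => hf u hu hu0

/-- The linear form `∑ cᵢ xᵢ⁻¹` cleared of denominators. -/
noncomputable def clearedForm {ι : Type*} [Fintype ι] (c : ι → ℂ) : MvPolynomial ι ℂ :=
  ∑ i, C (c i) * ∏ j ∈ Finset.univ.erase i, X j

theorem eval_clearedForm {ι : Type*} [Fintype ι] (c : ι → ℂ) {x : ι → ℂ} (hx : ∀ i, x i ≠ 0) :
    eval x (clearedForm c) = (∏ j, x j) * ∑ i, c i * (x i)⁻¹ := by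
  rw [clearedForm, map_sum, Finset.mul_sum]
  refine Finset.sum_congr rfl fun i _ => ?_
  rw [← Finset.mul_prod_erase Finset.univ x (Finset.mem_univ i)]
  simp only [map_mul, eval_C, map_prod, eval_X]
  field_simp [hx i]

theorem clearedForm_mem_vIdeal {ι : Type*} [Fintype ι] {L : Submodule ℂ (ι → ℂ)} {c : ι → ℂ}
    (hc : ∀ u ∈ L, ∑ i, c i * u i = 0) : clearedForm c ∈ vIdeal (reciprocalPlane L) := by
  rw [mem_vIdeal_reciprocalPlane]
  intro u hu hu0
  rw [eval_clearedForm c fun i => inv_ne_zero (hu0 i)]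
  simp [hc u hu]

theorem LinearMap.apply_eq_sum_smul_single {ι R M : Type*} [Fintype ι] [Semiring R]
    [AddCommMonoid M] [Module R M] (φ : (ι → R) →ₗ[R] M) (u : ι → R) :
    φ u = ∑ i, u i • φ (Pi.single i 1) := by
  conv_lhs => rw [pi_eq_sum_univ' u]
  simp only [map_sum, map_smul]

theorem inv_mem_of_mem_reciprocalPlane {ι : Type*} [Fintype ι] {L : Submodule ℂ (ι → ℂ)}
    {p : ι → ℂ} (hp : p ∈ reciprocalPlane L) (hp0 : ∀ i, p i ≠ 0) :
    (fun i => (p i)⁻¹) ∈ L := by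
  by_contra hmem
  obtain ⟨φ, hφ, hL⟩ := Submodule.exists_le_ker_of_notMem hmem
  have hsum (u : ι → ℂ) : φ u = ∑ i, φ (Pi.single i 1) * u i := by
    rw [φ.apply_eq_sum_smul_single u]
    exact Finset.sum_congr rfl fun i _ => mul_comm _ _
  have h := clearedForm_mem_vIdeal (L := L) (c := fun i => φ (Pi.single i 1))
    (fun u hu => by rw [← hsum]; exact hL hu) p hp
  rw [eval_clearedForm _ hp0, ← hsum] at h
  exact (mul_ne_zero (Finset.prod_ne_zero_iff.mpr fun i _ => hp0 i) hφ) h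

theorem coeff_zero_prod_X_add_C {ι : Type*} (p : ι → ℂ) (s : Finset ι) :
    coeff 0 (∏ j ∈ s, (X j + C (p j))) = ∏ j ∈ s, p j := by
  rw [← constantCoeff_eq]
  simp

theorem coeff_single_prod_X_add_C {ι : Type*} {p : ι → ℂ} (hp0 : ∀ i, p i ≠ 0) (s : Finset ι)
    (k : ι) : coeff (Finsupp.single k 1) (∏ j ∈ s, (X j + C (p j))) =
      if k ∈ s then (∏ j ∈ s, p j) * (p k)⁻¹ else 0 := by
  induction s using Finset.induction_on with
  | empty =>
    have : (0 : ι →₀ ℕ) ≠ Finsupp.single k 1 := (Finsupp.single_ne_zero.mpr one_ne_zero).symm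
    simp [coeff_one, this]
  | insert a s ha ih =>
    rw [Finset.prod_insert ha, Finset.prod_insert ha, add_mul, coeff_add, coeff_C_mul, ih,
      coeff_X_mul']
    have := hp0 k
    by_cases hka : k = a
    · subst hka
      simp [ha, coeff_zero_prod_X_add_C]
      field_simp
    · by_cases hks : k ∈ s <;>
        simp [hka, Ne.symm hka, hks, mul_assoc]

theorem initForm_eq_of_coeff_zero {ι : Type*} [Fintype ι] {F : MvPolynomial ι ℂ} {b : ι → ℂ}
    (hF0 : coeff 0 F = 0) (hF1 : ∀ k, coeff (Finsupp.single k 1) F = b k) (hb : b ≠ 0) :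
    initForm F = ∑ k, C (b k) * X k := by
  have h0 : homogeneousComponent 0 F = 0 := by rw [homogeneousComponent_zero, hF0, C_0]
  have h1 : homogeneousComponent 1 F = ∑ k, C (b k) * X k := by
    ext m
    rw [coeff_homogeneousComponent]
    split_ifs with hm
    · obtain ⟨k, rfl⟩ := (Finsupp.sum_eq_one_iff m).mp hm
      simp [hF1, coeff_sum, coeff_C_mul, coeff_X, Finsupp.single_left_inj]
    · symm
      simp only [coeff_sum, coeff_C_mul, coeff_X]
      refine Finset.sum_eq_zero fun k _ => ?_
      rw [if_neg, mul_zero]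
      rintro rfl
      simp at hm
  have h1' : homogeneousComponent 1 F ≠ 0 := by
    intro h
    obtain ⟨k, hk⟩ := Function.ne_iff.mp hb
    apply hk
    rw [← hF1 k]
    have := congrArg (coeff (Finsupp.single k 1)) h
    rwa [coeff_homogeneousComponent, if_pos (by simp)] at this
  have hinf : sInf {k | homogeneousComponent k F ≠ 0} = 1 := by
    refine le_antisymm (Nat.sInf_le h1') (Nat.one_le_iff_ne_zero.mpr fun h => ?_)
    have := Nat.sInf_mem (s := {k | homogeneousComponent k F ≠ 0}) ⟨1, h1'⟩
    rw [h] at this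
    exact this h0
  rw [initForm, hinf, h1]

theorem initForm_clearedForm {ι : Type*} [Fintype ι] {p c : ι → ℂ} (hp0 : ∀ i, p i ≠ 0)
    (hcp : ∑ i, c i * (p i)⁻¹ = 0) (hc : c ≠ 0) :
    initForm (aeval (fun i => X i + C (p i)) (clearedForm c)) =
      C (-∏ j, p j) * ∑ k, C (c k * ((p k) ^ 2)⁻¹) * X k := by
  have hP : (∏ j, p j) ≠ 0 := Finset.prod_ne_zero_iff.mpr fun i _ => hp0 i
  have herase (i : ι) : ∏ j ∈ Finset.univ.erase i, p j = (∏ j, p j) * (p i)⁻¹ := by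
    rw [← Finset.mul_prod_erase Finset.univ p (Finset.mem_univ i), mul_right_comm,
      mul_inv_cancel₀ (hp0 i), one_mul]
  have hF : aeval (fun i => X i + C (p i)) (clearedForm c) =
      ∑ i, C (c i) * ∏ j ∈ Finset.univ.erase i, (X j + C (p j)) := by
    simp [clearedForm, algebraMap_eq]
  rw [initForm_eq_of_coeff_zero (b := fun k => -(∏ j, p j) * (c k * ((p k) ^ 2)⁻¹))]
  · rw [Finset.mul_sum]
    simp only [C_mul, mul_assoc]
  · simp only [hF, coeff_sum, coeff_C_mul, coeff_zero_prod_X_add_C, herase]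
    simp only [mul_left_comm (c _), ← Finset.mul_sum, hcp, mul_zero]
  · intro k
    simp only [hF, coeff_sum, coeff_C_mul, coeff_single_prod_X_add_C hp0, herase]
    have hsplit (i : ι) : c i * (if k ∈ Finset.univ.erase i then
        (∏ j, p j) * (p i)⁻¹ * (p k)⁻¹ else 0) =
        (∏ j, p j) * (p k)⁻¹ * (c i * (p i)⁻¹) -
          if k = i then (∏ j, p j) * (c k * ((p k) ^ 2)⁻¹) else 0 := by
      by_cases hki : k = i
      · subst hki
        simp
        ring
      · simp [hki]
        ring
    simp only [hsplit, Finset.sum_sub_distrib, ← Finset.mul_sum, hcp]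
    simp
  · obtain ⟨k, hk⟩ := Function.ne_iff.mp hc
    exact Function.ne_iff.mpr ⟨k, mul_ne_zero (neg_ne_zero.mpr hP)
      (mul_ne_zero hk (inv_ne_zero (pow_ne_zero 2 (hp0 k))))⟩

/-- The vanishing ideal of a linear subspace is generated by linear forms. -/
theorem vIdeal_submodule_le {ι : Type*} [Fintype ι] (W : Submodule ℂ (ι → ℂ))
    {I : Ideal (MvPolynomial ι ℂ)}
    (hI : ∀ c : ι → ℂ, (∀ w ∈ W, ∑ i, c i * w i = 0) → ∑ i, C (c i) * X i ∈ I) :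
    vIdeal (W : Set (ι → ℂ)) ≤ I := by
  intro f hf
  obtain ⟨g, hg⟩ := LinearMap.exists_leftInverse_of_injective W.subtype W.ker_subtype
  let π : (ι → ℂ) →ₗ[ℂ] (ι → ℂ) := W.subtype ∘ₗ g
  have hπ (w : ι → ℂ) (hw : w ∈ W) : π w = w :=
    congrArg Subtype.val (LinearMap.congr_fun hg ⟨w, hw⟩)
  let q (i : ι) : MvPolynomial ι ℂ := ∑ j, C (π (Pi.single j 1) i) * X j
  have hsum (x : ι → ℂ) (i : ι) : π x i = ∑ j, π (Pi.single j 1) i * x j := by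
    rw [π.apply_eq_sum_smul_single x, Finset.sum_apply]
    exact Finset.sum_congr rfl fun j _ => mul_comm _ _
  have hq (x : ι → ℂ) (i : ι) : eval x (q i) = π x i := by
    simp [q, hsum x i]
  have hzero : aeval q f = 0 := by
    refine MvPolynomial.funext fun x => ?_
    rw [map_zero, aeval_def, ← coe_eval₂Hom, ← RingHom.comp_apply]
    have : (eval x).comp (eval₂Hom (algebraMap ℂ (MvPolynomial ι ℂ)) q) = eval (π x) := by
      ext <;> simp [hq, algebraMap_eq]
    rw [this]
    exact hf _ (g x).2
  have hcongr : Ideal.Quotient.mk I f = Ideal.Quotient.mk I (aeval q f) := by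
    have : (Ideal.Quotient.mk I) =
        (Ideal.Quotient.mk I).comp (aeval q : MvPolynomial ι ℂ →ₐ[ℂ] _).toRingHom := by
      ext i
      · simp [algebraMap_eq]
      · simp only [AlgHom.toRingHom_eq_coe, RingHom.comp_apply, RingHom.coe_coe, aeval_X]
        rw [Ideal.Quotient.eq]
        have := hI (fun j => (if j = i then 1 else 0) - π (Pi.single j 1) i) (fun w hw => by
          simp only [sub_mul, Finset.sum_sub_distrib, ← hsum, hπ w hw]
          simp)
        simpa [q, sub_mul, Finset.sum_sub_distrib, apply_ite C] using this
    exact congrArg (fun φ => φ f) this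
  rw [hzero, map_zero] at hcongr
  exact Ideal.Quotient.eq_zero_iff_mem.mp hcongr

theorem MvPolynomial.IsHomogeneous.eval_smul {ι R : Type*} [CommSemiring R]
    {F : MvPolynomial ι R} {m : ℕ} (hF : F.IsHomogeneous m) (t : R) (y : ι → R) :
    eval (t • y) F = t ^ m * eval y F := by
  rw [eval_eq, eval_eq, Finset.mul_sum]
  refine Finset.sum_congr rfl fun d hd => ?_
  have hdeg : ∑ i ∈ d.support, d i = m := by
    rw [← Finsupp.degree_apply, Finsupp.degree_eq_weight_one]
    exact hF (mem_support_iff.mp hd)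
  simp only [Pi.smul_apply, smul_eq_mul, mul_pow, Finset.prod_mul_distrib,
    Finset.prod_pow_eq_pow_sum, hdeg, mul_left_comm]

/-- If `F` vanishes along `t • y t` for small `t ≠ 0`, then its initial form vanishes at `y 0`. -/
theorem eval_initForm_eq_zero_s13 {ι : Type*} [Fintype ι] (F : MvPolynomial ι ℂ) {y : ℂ → ι → ℂ}
    (hy : ContinuousAt y 0)
    (hF : ∀ᶠ t in nhdsWithin (0 : ℂ) {0}ᶜ, eval (t • y t) F = 0) :
    eval (y 0) (initForm F) = 0 := by
  set k := sInf {k | homogeneousComponent k F ≠ 0} with hk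
  have hlow (m : ℕ) (hm : m < k) : homogeneousComponent m F = 0 := by
    by_contra h
    exact Nat.notMem_of_lt_sInf hm h
  let G (t : ℂ) : ℂ := ∑ m ∈ Finset.range (F.totalDegree + 1),
    t ^ (m - k) * eval (y t) (homogeneousComponent m F)
  have hfac (t : ℂ) : eval (t • y t) F = t ^ k * G t := by
    conv_lhs => rw [← sum_homogeneousComponent F]
    rw [map_sum, Finset.mul_sum]
    refine Finset.sum_congr rfl fun m _ => ?_
    rcases lt_or_ge m k with hm | hm
    · simp [hlow m hm]
    · rw [← mul_assoc, ← pow_add, Nat.add_sub_cancel' hm]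
      exact (homogeneousComponent_isHomogeneous m F).eval_smul t (y t)
  have hG : ContinuousAt G 0 := by
    refine tendsto_finsetSum _ fun m _ => ?_
    exact ((continuous_pow _).continuousAt).mul
      ((MvPolynomial.continuous_eval _).continuousAt.comp hy)
  have hGz : ∀ᶠ t in nhdsWithin (0 : ℂ) {0}ᶜ, G t = 0 := by
    filter_upwards [hF, self_mem_nhdsWithin] with t ht ht0
    rw [hfac] at ht
    exact (mul_eq_zero.mp ht).resolve_left (pow_ne_zero _ ht0)
  have hG0 : G 0 = 0 :=
    tendsto_nhds_unique (hG.tendsto.mono_left nhdsWithin_le_nhds)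
      (tendsto_const_nhds.congr' (hGz.mono fun _ h => h.symm))
  rw [initForm, ← hk]
  by_cases hkr : k ∈ Finset.range (F.totalDegree + 1)
  · have hGk : G 0 = 0 ^ (k - k) * eval (y 0) (homogeneousComponent k F) := by
      refine Finset.sum_eq_single_of_mem k hkr ?_
      intro m _ hmk
      rcases lt_or_gt_of_ne hmk with hm | hm
      · simp [hlow m hm]
      · simp [(Nat.sub_pos_of_lt hm).ne']
    simpa [hG0] using hGk.symm
  · rw [homogeneousComponent_eq_zero _ _ (by simpa using hkr), map_zero]

theorem eval_initForm_reciprocalPlane {ι : Type*} [Fintype ι] {L : Submodule ℂ (ι → ℂ)}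
    {p : ι → ℂ} (hp0 : ∀ i, p i ≠ 0) (hpL : (fun i => (p i)⁻¹) ∈ L) {f : MvPolynomial ι ℂ}
    (hf : f ∈ vIdeal (reciprocalPlane L)) {v : ι → ℂ} (hv : v ∈ L) :
    eval (fun i => v i * p i ^ 2) (initForm (aeval (fun i => X i + C (p i)) f)) = 0 := by
  let y (t : ℂ) (i : ι) : ℂ := v i * p i ^ 2 / (1 - t * (p i * v i))
  have hy0 : y 0 = fun i => v i * p i ^ 2 := by
    ext i
    simp [y]
  have hden (i : ι) : ContinuousAt (fun t : ℂ => 1 - t * (p i * v i)) 0 := by fun_prop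
  have hy : ContinuousAt y 0 :=
    continuousAt_pi.mpr fun i => continuousAt_const.div (hden i) (by simp)
  rw [← hy0]
  refine eval_initForm_eq_zero_s13 _ hy ?_
  have hne : ∀ᶠ t in nhds (0 : ℂ), ∀ i, 1 - t * (p i * v i) ≠ 0 :=
    Filter.eventually_all.mpr fun i => (hden i).eventually_ne (by simp)
  filter_upwards [nhdsWithin_le_nhds hne] with t ht
  have hu : (fun i => (p i)⁻¹) - t • v ∈ L := L.sub_mem hpL (L.smul_mem t hv)
  have hu_eq (i : ι) : ((fun i => (p i)⁻¹) - t • v) i = (1 - t * (p i * v i)) * (p i)⁻¹ := by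
    simp only [Pi.sub_apply, Pi.smul_apply, smul_eq_mul]
    field_simp [hp0 i]
  have hz := mem_vIdeal_reciprocalPlane.mp hf _ hu fun i => by
    rw [hu_eq]
    exact mul_ne_zero (ht i) (inv_ne_zero (hp0 i))
  have hcomp : (eval (t • y t)).comp
      (aeval (fun i => X i + C (p i)) : MvPolynomial ι ℂ →ₐ[ℂ] MvPolynomial ι ℂ).toRingHom =
      eval (fun i => (((fun i => (p i)⁻¹) - t • v) i)⁻¹) := by
    ext i
    · simp [algebraMap_eq]
    · have hi := ht i
      simp only [AlgHom.toRingHom_eq_coe, RingHom.comp_apply, RingHom.coe_coe, aeval_X, map_add,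
        eval_X, eval_C, hu_eq, Pi.smul_apply, smul_eq_mul, y, mul_inv, inv_inv]
      linear_combination (-p i) * mul_inv_cancel₀ hi
  rw [← hz, ← hcomp]
  rfl

theorem tangentConeIdeal_reciprocalPlane {ι : Type*} [Fintype ι] {L W : Submodule ℂ (ι → ℂ)}
    {p : ι → ℂ} (hp : p ∈ reciprocalPlane L) (hp0 : ∀ i, p i ≠ 0)
    (hW : ∀ w, w ∈ W ↔ ∃ v ∈ L, (fun i => v i * p i ^ 2) = w) :
    tangentConeIdeal (reciprocalPlane L) p = vIdeal (W : Set (ι → ℂ)) := by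
  have hpL := inv_mem_of_mem_reciprocalPlane hp hp0
  apply le_antisymm
  · refine Ideal.span_le.mpr ?_
    rintro _ ⟨f, hf, -, rfl⟩ w hw
    obtain ⟨v, hv, rfl⟩ := (hW w).mp hw
    exact eval_initForm_reciprocalPlane hp0 hpL hf hv
  · refine vIdeal_submodule_le W fun b hb => ?_
    by_cases hb0 : b = 0
    · simp [hb0]
    let c (i : ι) : ℂ := b i * p i ^ 2
    have hcL (u : ι → ℂ) (hu : u ∈ L) : ∑ i, c i * u i = 0 := by
      rw [← hb _ ((hW _).mpr ⟨u, hu, rfl⟩)]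
      exact Finset.sum_congr rfl fun i _ => by ring
    have hc0 : c ≠ 0 := by
      obtain ⟨k, hk⟩ := Function.ne_iff.mp hb0
      exact Function.ne_iff.mpr ⟨k, mul_ne_zero hk (pow_ne_zero 2 (hp0 k))⟩
    have hinit := initForm_clearedForm hp0 (hcL _ hpL) hc0
    have hP : (∏ j, p j) ≠ 0 := Finset.prod_ne_zero_iff.mpr fun i _ => hp0 i
    have hmem : initForm (aeval (fun i => X i + C (p i)) (clearedForm c)) ∈
        tangentConeIdeal (reciprocalPlane L) p := by
      by_cases hne : clearedForm c = 0
      · simp [hne, initForm]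
      · exact Ideal.subset_span ⟨_, clearedForm_mem_vIdeal hcL, hne, rfl⟩
    rw [hinit] at hmem
    have := Ideal.mul_mem_left _ (C (-∏ j, p j)⁻¹) hmem
    rw [← mul_assoc, ← C_mul, inv_mul_cancel₀ (neg_ne_zero.mpr hP), C_1, one_mul] at this
    simpa [c, hp0] using this

/-- At a point `p` of the reciprocal plane `L⁻¹` with all coordinates nonzero, the tangent
cone of `L⁻¹` is the linear space `rowspan(A·diag(p)²)`. -/
theorem stmt_13 {d n : ℕ} (A : Matrix (Fin d) (Fin n) ℝ)
    (hrank : A.rank = d) (hcol : ∀ j : Fin n, (fun i => A i j) ≠ 0)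
    (p : Fin n → ℂ) (hp : p ∈ reciprocalPlane (rowSpaceC A)) (hp0 : ∀ j, p j ≠ 0) :
    tangentConeIdeal (reciprocalPlane (rowSpaceC A)) p =
      vIdeal (↑(Submodule.span ℂ (Set.range fun i : Fin d =>
        fun j : Fin n => (A i j : ℂ) * p j ^ 2)) : Set (Fin n → ℂ)) := by
  refine tangentConeIdeal_reciprocalPlane hp hp0 fun w => ?_
  let D : (Fin n → ℂ) →ₗ[ℂ] (Fin n → ℂ) := LinearMap.mulRight ℂ (fun j => p j ^ 2)
  have hrange : (Set.range fun i : Fin d => fun j : Fin n => (A i j : ℂ) * p j ^ 2) =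
      D '' Set.range fun i : Fin d => fun j : Fin n => (A i j : ℂ) := by
    rw [← Set.range_comp]
    rfl
  rw [hrange, Submodule.span_image]
  rfl
end

section
/- Let A be a real d×n matrix of rank d with no zero columns and let L^{−1} ⊆ ℂ^n be the reciprocal plane of the ℂ-row space L of A. Then L^{−1} ∩ { x ∈ ℂ^n : A·x = 0 } = {0}. (Equivalently, the projective variety L^{−1} ⊆ ℙ^{n−1} is disjoint from the center of the linear projection ℙ^{n−1} ⇢ ℙ^{d−1}, x ↦ A·x, so the map A : L^{−1} → ℙ^{d−1} is a morphism.) -/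
/-- If `L` has a vector with no zero coordinate, then `L⁻¹` contains the origin. -/
theorem zero_mem_reciprocalPlane {ι : Type*} {L : Submodule ℂ (ι → ℂ)} {u : ι → ℂ}
    (hu : u ∈ L) (hu0 : ∀ i, u i ≠ 0) : (0 : ι → ℂ) ∈ reciprocalPlane L := by
  intro f hf
  have key (f : MvPolynomial ι ℂ) (t : ℂ) : (MvPolynomial.aeval
      (fun i => Polynomial.C (u i)⁻¹ * Polynomial.X) f : Polynomial ℂ).eval t =
      MvPolynomial.eval (fun i => (u i)⁻¹ * t) f := by
    induction f using MvPolynomial.induction_on with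
    | C a => simp
    | add p q hp hq => simp_all
    | mul_X p i hp => simp_all
  have hp : (MvPolynomial.aeval
      (fun i => Polynomial.C (u i)⁻¹ * Polynomial.X) f : Polynomial ℂ) = 0 := by
    refine Polynomial.eq_zero_of_infinite_isRoot _
      ((Set.finite_singleton (0 : ℂ)).infinite_compl.mono fun t ht => ?_)
    have ht : t ≠ 0 := ht
    have h := hf (t⁻¹ • u) (L.smul_mem _ hu)
      fun i => mul_ne_zero (inv_ne_zero ht) (hu0 i)
    rw [Set.mem_ofPred_eq, Polynomial.IsRoot, key f, ← h]
    congr 2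
    funext i
    simp [mul_comm]
  have h := key f 0
  rw [hp, Polynomial.eval_zero] at h
  rw [h]
  congr 2
  funext i
  simp

/-- A point of `L⁻¹` that is orthogonal to `L` for the bilinear dot product is zero. -/
theorem eq_zero_of_mem_reciprocalPlane {ι : Type*} [Fintype ι] {L : Submodule ℂ (ι → ℂ)}
    {x : ι → ℂ} (hx : x ∈ reciprocalPlane L) (horth : ∀ u ∈ L, u ⬝ᵥ x = 0) : x = 0 := by
  classical
  set S : Finset ι := Finset.univ.filter fun i => x i ≠ 0 with hS
  have hf := hx (∑ i ∈ S, MvPolynomial.C (x i) * ∏ j ∈ S.erase i, MvPolynomial.X j) ?_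
  · have hprod : ∏ j ∈ S, x j ≠ 0 :=
      Finset.prod_ne_zero_iff.mpr fun j hj => (Finset.mem_filter.mp hj).2
    simp only [map_sum, map_mul, map_prod, MvPolynomial.eval_C, MvPolynomial.eval_X] at hf
    rw [Finset.sum_congr rfl fun i hi => Finset.mul_prod_erase S x hi, Finset.sum_const,
      nsmul_eq_mul, mul_eq_zero, or_iff_left hprod, Nat.cast_eq_zero, Finset.card_eq_zero] at hf
    funext i
    by_contra hi
    exact Finset.notMem_empty i (hf ▸ Finset.mem_filter.mpr ⟨Finset.mem_univ i, hi⟩)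
  · intro u hu hu0
    simp only [map_sum, map_mul, map_prod, MvPolynomial.eval_C, MvPolynomial.eval_X]
    have hterm (i : ι) (hi : i ∈ S) :
        x i * ∏ j ∈ S.erase i, (u j)⁻¹ = (u i * x i) * ∏ j ∈ S, (u j)⁻¹ := by
      rw [← Finset.mul_prod_erase S (fun j => (u j)⁻¹) hi]
      field_simp [hu0 i]
    rw [Finset.sum_congr rfl hterm, ← Finset.sum_mul]
    have hsum : ∑ i ∈ S, u i * x i = u ⬝ᵥ x :=
      Finset.sum_subset (Finset.subset_univ S) fun i _ hi => by
        have : x i = 0 := by simpa [hS] using hi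
        simp [this]
    rw [hsum, horth u hu, zero_mul]

/-- If `A` has no zero column, its row space has a vector with no zero coordinate. -/
theorem exists_mem_rowSpaceC_forall_ne_zero {d n : ℕ} (A : Matrix (Fin d) (Fin n) ℝ)
    (hcol : ∀ j : Fin n, (fun i => A i j) ≠ 0) :
    ∃ u ∈ rowSpaceC A, ∀ j, u j ≠ 0 := by
  refine Module.Dual.exists_forall_mem_ne_zero_of_forall_exists (rowSpaceC A)
    (fun j => (LinearMap.proj j : Module.Dual ℂ (Fin n → ℂ))) fun j => ?_
  obtain ⟨i, hi⟩ := Function.ne_iff.mp (hcol j)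
  exact ⟨_, Submodule.subset_span ⟨i, rfl⟩, by simpa using hi⟩

/-- The reciprocal plane `L⁻¹` meets the kernel of `A` only in the origin, so the linear
projection `x ↦ A·x` restricts to a morphism `L⁻¹ → ℙ^{d−1}`. -/
theorem stmt_14 {d n : ℕ} (A : Matrix (Fin d) (Fin n) ℝ)
    (hrank : A.rank = d) (hcol : ∀ j : Fin n, (fun i => A i j) ≠ 0) :
    reciprocalPlane (rowSpaceC A) ∩
        {x : Fin n → ℂ | (A.map ((↑) : ℝ → ℂ)).mulVec x = 0} = {0} := by
  ext x
  rw [Set.mem_singleton_iff]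
  constructor
  · rintro ⟨hx, hAx⟩
    refine eq_zero_of_mem_reciprocalPlane hx fun u hu => ?_
    induction hu using Submodule.span_induction with
    | mem v hv =>
      obtain ⟨i, rfl⟩ := hv
      exact congrFun hAx i
    | zero => exact zero_dotProduct x
    | add v w _ _ hv hw => rw [add_dotProduct, hv, hw, add_zero]
    | smul c v _ hv => rw [smul_dotProduct, hv, smul_zero]
  · rintro rfl
    obtain ⟨u, hu, hu0⟩ := exists_mem_rowSpaceC_forall_ne_zero A hcol
    exact ⟨zero_mem_reciprocalPlane hu hu0, Matrix.mulVec_zero _⟩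
end

section
/- Let n ≥ 2 and L = { u ∈ ℂ^n : u_1 + u_2 + ⋯ + u_n = 0 }. Then the reciprocal plane L^{−1}, the Zariski closure in ℂ^n of { (u_1^{−1},…,u_n^{−1}) : u ∈ L, u_i ≠ 0 for all i }, equals the hypersurface { x ∈ ℂ^n : e_{n−1}(x_1,…,x_n) = 0 }, where e_{n−1}(x) = Σ_{i=1}^n ∏_{j≠i} x_j is the (n−1)-st elementary symmetric polynomial. -/
open Filter Topology in
/-- Points that are Euclidean limits of coordinatewise inverses of vectors of `L` lie in `L⁻¹`. -/
lemma mem_reciprocalPlane_of_tendsto {ι α : Type*} {L : Submodule ℂ (ι → ℂ)} {x : ι → ℂ}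
    {l : Filter α} [l.NeBot] {u : α → ι → ℂ} (hL : ∀ᶠ s in l, u s ∈ L)
    (h0 : ∀ᶠ s in l, ∀ i, u s i ≠ 0) (hu : ∀ i, Tendsto (fun s => (u s i)⁻¹) l (𝓝 (x i))) :
    x ∈ reciprocalPlane L := by
  intro f hf
  have hlim : Tendsto (fun s => MvPolynomial.eval (fun i => (u s i)⁻¹) f) l
      (𝓝 (MvPolynomial.eval x f)) :=
    (MvPolynomial.continuous_eval f).continuousAt.tendsto.comp (tendsto_pi_nhds.2 hu)
  refine tendsto_nhds_unique hlim (tendsto_const_nhds.congr' ?_)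
  filter_upwards [hL, h0] with s h1 h2
  exact (hf (u s) h1 h2).symm

open Filter Topology in
/-- If `a, c ∈ L` satisfy `cᵢ ≠ 0` exactly where `xᵢ = 0`, and `aᵢ = xᵢ⁻¹` elsewhere, then the
inverses of `a + s⁻¹ c` tend to `x` as `s → 0`. -/
lemma mem_reciprocalPlane_of_line {ι : Type*} [Finite ι] {L : Submodule ℂ (ι → ℂ)}
    {x a c : ι → ℂ} (ha : a ∈ L) (hc : c ∈ L) (hzero : ∀ i, x i = 0 → c i ≠ 0)
    (hne : ∀ i, x i ≠ 0 → c i = 0 ∧ a i = (x i)⁻¹) : x ∈ reciprocalPlane L := by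
  have hdenom (i : ι) (hi : x i = 0) : ∀ᶠ s in 𝓝[≠] (0 : ℂ), a i * s + c i ≠ 0 := by
    have hcont : ContinuousAt (fun s : ℂ => a i * s + c i) 0 := by fun_prop
    exact (hcont.eventually_ne (by simpa using hzero i hi)).filter_mono nhdsWithin_le_nhds
  have hs : ∀ᶠ s in 𝓝[≠] (0 : ℂ), s ≠ 0 := self_mem_nhdsWithin
  refine mem_reciprocalPlane_of_tendsto (l := 𝓝[≠] (0 : ℂ)) (u := fun s => a + s⁻¹ • c)
    (Eventually.of_forall fun s => L.add_mem ha (L.smul_mem _ hc)) ?_ fun i => ?_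
  · refine eventually_all.2 fun i => ?_
    by_cases hi : x i = 0
    · filter_upwards [hs, hdenom i hi] with s h1 h2 h3
      apply h2
      simp only [Pi.add_apply, Pi.smul_apply, smul_eq_mul] at h3
      field_simp at h3
      simpa using h3
    · obtain ⟨h1, h2⟩ := hne i hi
      simp [h1, h2, hi]
  · by_cases hi : x i = 0
    · have hlim : Tendsto (fun s : ℂ => s / (a i * s + c i)) (𝓝[≠] 0) (𝓝 (x i)) := by
        have hcont : ContinuousAt (fun s : ℂ => s / (a i * s + c i)) 0 :=
          ContinuousAt.div (by fun_prop) (by fun_prop) (by simpa using hzero i hi)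
        simpa [hi] using hcont.tendsto.mono_left nhdsWithin_le_nhds
      refine hlim.congr' ?_
      filter_upwards [hs] with s h1
      simp only [Pi.add_apply, Pi.smul_apply, smul_eq_mul]
      rw [← inv_div]
      congr 1
      field_simp
    · obtain ⟨h1, h2⟩ := hne i hi
      simp [h1, h2]

/-- At a point with nonzero coordinates, `e_{n−1}(x) = (∏ xᵢ) (Σ xᵢ⁻¹)`. -/
lemma sum_prod_compl_singleton {ι K : Type*} [Fintype ι] [DecidableEq ι] [Field K] {x : ι → K}
    (hx : ∀ i, x i ≠ 0) :
    ∑ i, ∏ j ∈ ({i}ᶜ : Finset ι), x j = (∏ i, x i) * ∑ i, (x i)⁻¹ := by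
  rw [Finset.mul_sum]
  refine Finset.sum_congr rfl fun i _ => ?_
  rw [Fintype.prod_eq_mul_prod_compl i, mul_right_comm, mul_inv_cancel₀ (hx i), one_mul]

/-- If `e_{n−1}` vanishes at `x` and one coordinate of `x` is zero, then so is another one. -/
lemma exists_ne_eq_zero_of_sum_prod_compl_singleton {ι K : Type*} [Fintype ι] [DecidableEq ι]
    [Field K] {x : ι → K} (hx : ∑ i, ∏ j ∈ ({i}ᶜ : Finset ι), x j = 0) {k : ι} (hk : x k = 0) :
    ∃ j, j ≠ k ∧ x j = 0 := by
  rw [Fintype.sum_eq_single k fun i hi =>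
    Finset.prod_eq_zero (by simpa using hi.symm) hk] at hx
  obtain ⟨j, hj, hj0⟩ := Finset.prod_eq_zero_iff.1 hx
  exact ⟨j, by simpa using hj, hj0⟩

/-- The reciprocal plane of the hyperplane `{u : Σ uᵢ = 0}` is the hypersurface cut out by
the `(n−1)`-st elementary symmetric polynomial `e_{n−1}(x) = Σᵢ ∏_{j≠i} xⱼ`. -/
theorem stmt_17 (n : ℕ) (hn : 2 ≤ n) :
    reciprocalPlane
        (LinearMap.ker (∑ i : Fin n, LinearMap.proj i : (Fin n → ℂ) →ₗ[ℂ] ℂ)) =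
      {x : Fin n → ℂ | ∑ i : Fin n, ∏ j ∈ ({i}ᶜ : Finset (Fin n)), x j = 0} := by
  ext x
  refine ⟨fun hx => ?_, fun hx => ?_⟩
  · have h := hx (∑ i, ∏ j ∈ ({i}ᶜ : Finset (Fin n)), MvPolynomial.X j) fun u hu h0 => by
      simp only [map_sum, map_prod, MvPolynomial.eval_X]
      rw [sum_prod_compl_singleton fun i => inv_ne_zero (h0 i)]
      simp only [LinearMap.mem_ker, LinearMap.sum_apply, LinearMap.proj_apply] at hu
      simp [hu]
    simpa using h
  · rw [Set.mem_ofPred_eq] at hx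
    by_cases hk : ∃ k, x k = 0
    · obtain ⟨k, hk⟩ := hk
      obtain ⟨j, hjk, hj⟩ := exists_ne_eq_zero_of_sum_prod_compl_singleton hx hk
      let b : Fin n → ℂ := fun i => if i ≠ k ∧ x i = 0 then 1 else 0
      have hb : ∑ i, b i ≠ 0 := by
        simp only [b, Finset.sum_boole]
        exact Nat.cast_ne_zero.2 (Finset.card_ne_zero_of_mem (a := j) (by simp [hjk, hj]))
      refine mem_reciprocalPlane_of_line
        (a := x⁻¹ - Pi.single k (∑ i, (x i)⁻¹)) (c := b - Pi.single k (∑ i, b i)) ?_ ?_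
        (fun i hi => ?_) fun i hi => ?_
      · simp [LinearMap.sum_apply, Finset.sum_sub_distrib]
      · simp [LinearMap.sum_apply, Finset.sum_sub_distrib]
      · by_cases hik : i = k
        · subst hik
          have hbi : b i = 0 := by simp [b]
          simpa [hbi] using hb
        · simp [b, hik, hi]
      · have hik : i ≠ k := fun h => hi (h ▸ hk)
        simp [b, hik, hi]
    · push Not at hk
      refine mem_reciprocalPlane_of_line (a := x⁻¹) (c := 0) ?_ (Submodule.zero_mem _)
        (fun i hi => absurd hi (hk i)) fun i _ => ⟨rfl, rfl⟩
      rw [sum_prod_compl_singleton hk, mul_eq_zero,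
        or_iff_right (Finset.prod_ne_zero_iff.2 fun i _ => hk i)] at hx
      simpa [LinearMap.sum_apply] using hx
end

section
/- Let n ≥ 2. In the polynomial ring ℂ[x_1,…,x_n] there is the ideal identity ⟨ e_{n−1}(x_1,…,x_n), e_{n−1}(x_1²,…,x_n²) ⟩ = ⟨ e_{n−1}(x_1,…,x_n), e_{n−2}(x_1,…,x_n) ⟩ ∩ ⋂_{1≤i<j≤n} ⟨ x_i², x_i + x_j ⟩. -/
open MvPolynomial

section HomImages

variable {σ R A : Type*} [Fintype σ] [CommRing R] [CommRing A]

theorem map_esymm_eq_coeff_prod (φ : MvPolynomial σ R →+* A) {k : ℕ} (h : k ≤ Fintype.card σ) :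
    φ (esymm σ R (Fintype.card σ - k)) =
      (∏ i : σ, (Polynomial.X + Polynomial.C (φ (X i)))).coeff k := by
  rw [← MvPolynomial.prod_X_add_C_coeff R σ k h, ← Polynomial.coeff_map, Polynomial.map_prod]
  simp

variable [DecidableEq σ]

theorem map_esymm_card_sub_one_of_map_X_eq_zero (φ : MvPolynomial σ R →+* A) {i : σ}
    (hi : φ (X i) = 0) :
    φ (esymm σ R (Fintype.card σ - 1)) = φ (∏ k ∈ Finset.univ.erase i, X k) := by
  have : 0 < Fintype.card σ := Fintype.card_pos_iff.mpr ⟨i⟩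
  rw [map_esymm_eq_coeff_prod φ this, ← Finset.mul_prod_erase _ _ (Finset.mem_univ i), hi]
  simp [Polynomial.coeff_zero_prod]

theorem prod_X_add_C_map_eq_of_pair (φ : MvPolynomial σ R →+* A) {i j : σ} (hij : i ≠ j)
    (hmul : φ (X i) * φ (X j) = 0) (hadd : φ (X i) + φ (X j) = 0) :
    ∏ k : σ, (Polynomial.X + Polynomial.C (φ (X k))) =
      (∏ k ∈ (Finset.univ.erase i).erase j, (Polynomial.X + Polynomial.C (φ (X k)))) *
        Polynomial.X ^ 2 := by
  rw [← Finset.mul_prod_erase _ _ (Finset.mem_univ i),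
    ← Finset.mul_prod_erase _ _ (Finset.mem_erase.mpr ⟨hij.symm, Finset.mem_univ j⟩)]
  have h1 := congrArg (Polynomial.C (R := A)) hmul
  have h2 := congrArg (Polynomial.C (R := A)) hadd
  simp only [Polynomial.C_mul, Polynomial.C_add, Polynomial.C_0] at h1 h2
  linear_combination (∏ k ∈ (Finset.univ.erase i).erase j,
    (Polynomial.X + Polynomial.C (φ (X k)))) * (h1 + Polynomial.X * h2)

theorem map_esymm_card_sub_one_of_pair (φ : MvPolynomial σ R →+* A) {i j : σ} (hij : i ≠ j)
    (hmul : φ (X i) * φ (X j) = 0) (hadd : φ (X i) + φ (X j) = 0) :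
    φ (esymm σ R (Fintype.card σ - 1)) = 0 := by
  rw [map_esymm_eq_coeff_prod φ (Fintype.card_pos_iff.mpr ⟨i⟩),
    prod_X_add_C_map_eq_of_pair φ hij hmul hadd, Polynomial.coeff_mul_X_pow']
  simp

theorem map_esymm_card_sub_two_of_pair (φ : MvPolynomial σ R →+* A) {i j : σ} (hij : i ≠ j)
    (hmul : φ (X i) * φ (X j) = 0) (hadd : φ (X i) + φ (X j) = 0) :
    φ (esymm σ R (Fintype.card σ - 2)) = φ (∏ k ∈ (Finset.univ.erase i).erase j, X k) := by
  have : 1 < Fintype.card σ := Fintype.one_lt_card_iff.mpr ⟨i, j, hij⟩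
  rw [map_esymm_eq_coeff_prod φ this, prod_X_add_C_map_eq_of_pair φ hij hmul hadd,
    Polynomial.coeff_mul_X_pow']
  simp [Polynomial.coeff_zero_prod]

end HomImages

section CoefficientConditions

variable {σ R : Type*} [CommRing R]

theorem aeval_sq_esymm_card_sub_one [Fintype σ] (h : 2 ≤ Fintype.card σ) :
    aeval (fun i : σ => (X i : MvPolynomial σ R) ^ 2) (esymm σ R (Fintype.card σ - 1)) =
      esymm σ R (Fintype.card σ - 1) ^ 2 -
        2 * ((∏ i, X i) * esymm σ R (Fintype.card σ - 2)) := by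
  set A : Polynomial (MvPolynomial σ R) := ∏ i, (Polynomial.X + Polynomial.C (X i)) with hA
  set B : Polynomial (MvPolynomial σ R) := ∏ i, (Polynomial.X + Polynomial.C (X i ^ 2)) with hB
  have hprod : A * A.comp (Polynomial.C (-1) * Polynomial.X) =
      Polynomial.expand _ 2 (B.comp (Polynomial.C (-1) * Polynomial.X)) := by
    rw [hA, hB, Polynomial.prod_comp, Polynomial.prod_comp, map_prod, ← Finset.prod_mul_distrib]
    refine Finset.prod_congr rfl fun i _ => ?_
    simp
    ring
  have hcoeff := congrArg (fun p => Polynomial.coeff p 2) hprod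
  have h1 : B.coeff 1 =
      aeval (fun i : σ => (X i : MvPolynomial σ R) ^ 2) (esymm σ R (Fintype.card σ - 1)) := by
    have := map_esymm_eq_coeff_prod (k := 1)
      (aeval (R := R) (fun i : σ => (X i : MvPolynomial σ R) ^ 2)).toRingHom (by omega)
    simpa [hB] using this.symm
  generalize aeval (fun i : σ => (X i : MvPolynomial σ R) ^ 2) (esymm σ R (Fintype.card σ - 1)) = T
    at h1 ⊢
  have hA0 : A.coeff 0 = ∏ i, X i := by simp [hA, Polynomial.coeff_zero_prod]
  have hA1 : A.coeff 1 = esymm σ R (Fintype.card σ - 1) :=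
    MvPolynomial.prod_X_add_C_coeff R σ 1 (by omega)
  have hA2 : A.coeff 2 = esymm σ R (Fintype.card σ - 2) :=
    MvPolynomial.prod_X_add_C_coeff R σ 2 h
  have hexp := Polynomial.coeff_expand_mul (p := 2) (by norm_num)
    (B.comp (Polynomial.C (-1) * Polynomial.X)) 1
  rw [one_mul] at hexp
  simp only [hexp, Polynomial.coeff_mul, Finset.Nat.sum_antidiagonal_eq_sum_range_succ_mk,
    Finset.sum_range_succ, Finset.sum_range_zero, Polynomial.comp_C_mul_X_coeff, h1] at hcoeff
  norm_num [hA0, hA1, hA2] at hcoeff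
  linear_combination hcoeff

/-- The conditions on the coefficients of `f` which cut out the ideal `⟨Xᵢ², Xᵢ + Xⱼ⟩`. -/
def PairCoeffCondition (i j : σ) (f : MvPolynomial σ R) : Prop :=
  ∀ u : σ →₀ ℕ, u i = 0 → u j = 0 →
    coeff u f = 0 ∧ coeff (u + Finsupp.single i 1) f = coeff (u + Finsupp.single j 1) f

theorem PairCoeffCondition.symm {i j : σ} {f : MvPolynomial σ R} (h : PairCoeffCondition i j f) :
    PairCoeffCondition j i f :=
  fun u hj hi => ⟨(h u hi hj).1, (h u hi hj).2.symm⟩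

theorem coeff_mul_X_eq_zero {i : σ} {v : σ →₀ ℕ} (h : v i = 0) (p : MvPolynomial σ R) :
    coeff v (p * X i) = 0 := by
  classical
  simp [coeff_mul_X', h]

theorem pairCoeffCondition_of_mem {i j : σ} (hij : i ≠ j) {f : MvPolynomial σ R}
    (hf : f ∈ Ideal.span {(X i : MvPolynomial σ R) ^ 2, X i + X j}) :
    PairCoeffCondition i j f := by
  obtain ⟨a, b, rfl⟩ := Ideal.mem_span_pair.mp hf
  intro u hi hj
  have hsq : a * X i ^ 2 + b * (X i + X j) = a * X i * X i + b * X i + b * X j := by ring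
  rw [hsq]
  have h1 : (u + Finsupp.single i 1 : σ →₀ ℕ) j = 0 := by simp [hj, hij]
  have h2 : (u + Finsupp.single j 1 : σ →₀ ℕ) i = 0 := by simp [hi, hij.symm]
  simp only [coeff_add, coeff_mul_X_eq_zero hi, coeff_mul_X_eq_zero hj, coeff_mul_X_eq_zero h1,
    coeff_mul_X_eq_zero h2, coeff_mul_X]
  simp

theorem PairCoeffCondition.of_mul_monomial {i j : σ} {f : MvPolynomial σ R} {d : σ →₀ ℕ}
    (hi : d i = 0) (hj : d j = 0) (h : PairCoeffCondition i j (f * monomial d 1)) :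
    PairCoeffCondition i j f := by
  intro u hui huj
  have := h (u + d) (by simp [hui, hi]) (by simp [huj, hj])
  rwa [add_right_comm u d, add_right_comm u d, coeff_mul_monomial, coeff_mul_monomial,
    coeff_mul_monomial, mul_one, mul_one, mul_one] at this

/-- The exponent of the squarefree monomial `∏ k ∈ s, X k`. -/
noncomputable def squarefreeExponent (s : Finset σ) : σ →₀ ℕ :=
  ∑ k ∈ s, Finsupp.single k 1

theorem squarefreeExponent_apply [DecidableEq σ] (s : Finset σ) (k : σ) :
    squarefreeExponent s k = if k ∈ s then 1 else 0 := by
  simp [squarefreeExponent, Finsupp.finsetSum_apply, Finsupp.single_apply]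

theorem prod_X_eq_monomial (s : Finset σ) :
    (∏ k ∈ s, X k : MvPolynomial σ R) = monomial (squarefreeExponent s) 1 := by
  rw [squarefreeExponent, monomial_sum_one]
  rfl

theorem squarefreeExponent_erase_add_single [DecidableEq σ] {s : Finset σ} {i : σ} (h : i ∈ s) :
    squarefreeExponent s = squarefreeExponent (s.erase i) + Finsupp.single i 1 :=
  (Finset.sum_erase_add _ _ h).symm

theorem mem_span_prod_X_of_coeff_eq_zero [Fintype σ] {f : MvPolynomial σ R}
    (h : ∀ (v : σ →₀ ℕ) (i : σ), v i = 0 → coeff v f = 0) :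
    f ∈ Ideal.span {(∏ i, X i : MvPolynomial σ R)} := by
  classical
  have := (mem_ideal_span_monomial_image (R := R) (x := f)
    (s := {squarefreeExponent (Finset.univ : Finset σ)})).mpr fun v hv => by
      refine ⟨_, rfl, fun i => ?_⟩
      have : v i ≠ 0 := fun hi => mem_support_iff.mp hv (h v i hi)
      simp [squarefreeExponent_apply]
      omega
  rwa [Set.image_singleton, ← prod_X_eq_monomial] at this

variable [Fintype σ] [DecidableEq σ]

theorem coeff_add_squarefreeExponent_erase_eq {f : MvPolynomial σ R}
    (h : ∀ i j : σ, i ≠ j → PairCoeffCondition i j f) {m : σ →₀ ℕ} {i j : σ}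
    (hi : m i = 0) (hj : m j = 0) :
    coeff (m + squarefreeExponent (Finset.univ.erase i)) f =
      coeff (m + squarefreeExponent (Finset.univ.erase j)) f := by
  rcases eq_or_ne i j with rfl | hij
  · rfl
  rw [squarefreeExponent_erase_add_single (s := Finset.univ.erase i) (i := j) (by simp [hij.symm]),
    squarefreeExponent_erase_add_single (s := Finset.univ.erase j) (i := i) (by simp [hij]),
    Finset.erase_right_comm (a := j), ← add_assoc, ← add_assoc]
  exact ((h i j hij _ (by simp [hi, squarefreeExponent_apply])
    (by simp [hj, squarefreeExponent_apply])).2).symm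

theorem exists_coeff_eq_coeff_add_squarefreeExponent {f : MvPolynomial σ R}
    (h : ∀ i j : σ, i ≠ j → PairCoeffCondition i j f) :
    ∃ g : MvPolynomial σ R, ∀ (m : σ →₀ ℕ) (i : σ), m i = 0 →
      coeff m g = coeff (m + squarefreeExponent (Finset.univ.erase i)) f := by
  classical
  let c : (σ →₀ ℕ) → R := fun m => if hm : ∃ i, m i = 0 then
    coeff (m + squarefreeExponent (Finset.univ.erase hm.choose)) f else 0
  have hc : ∀ (m : σ →₀ ℕ) (i : σ), m i = 0 →
      c m = coeff (m + squarefreeExponent (Finset.univ.erase i)) f := by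
    intro m i hi
    have hm : ∃ i, m i = 0 := ⟨i, hi⟩
    simp only [c, dif_pos hm]
    exact coeff_add_squarefreeExponent_erase_eq h hm.choose_spec hi
  let T : Finset (σ →₀ ℕ) := Finset.univ.biUnion fun i =>
    f.support.image (· - squarefreeExponent (Finset.univ.erase i))
  refine ⟨∑ m ∈ T, monomial m (c m), fun m i hi => ?_⟩
  rw [coeff_sum, ← hc m i hi]
  simp only [coeff_monomial, Finset.sum_ite_eq', ite_eq_left_iff]
  intro hT
  rw [hc m i hi]
  by_contra hne
  refine hT (Finset.mem_biUnion.mpr ⟨i, Finset.mem_univ i, Finset.mem_image.mpr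
    ⟨_, mem_support_iff.mpr (Ne.symm hne), ?_⟩⟩)
  simp

theorem mem_span_esymm_prod_X_of_pairCoeffCondition {f : MvPolynomial σ R}
    (h : ∀ i j : σ, i ≠ j → PairCoeffCondition i j f) :
    f ∈ Ideal.span {esymm σ R (Fintype.card σ - 1), ∏ i, X i} := by
  obtain ⟨g, hg⟩ := exists_coeff_eq_coeff_add_squarefreeExponent h
  have hmem : f - g * esymm σ R (Fintype.card σ - 1) ∈
      Ideal.span {(∏ i, X i : MvPolynomial σ R)} := by
    refine mem_span_prod_X_of_coeff_eq_zero fun v i hv => ?_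
    obtain ⟨t, ht⟩ : ∃ t, esymm σ R (Fintype.card σ - 1) =
        ∏ k ∈ Finset.univ.erase i, X k + t * X i := by
      have hX : Ideal.Quotient.mk (Ideal.span {(X i : MvPolynomial σ R)}) (X i) = 0 :=
        Ideal.Quotient.eq_zero_iff_mem.mpr (Ideal.mem_span_singleton_self _)
      have := Ideal.Quotient.eq.mp (map_esymm_card_sub_one_of_map_X_eq_zero _ hX)
      obtain ⟨t, ht⟩ := Ideal.mem_span_singleton'.mp this
      exact ⟨t, by rw [ht]; ring⟩
    rw [ht, mul_add, ← mul_assoc, coeff_sub, coeff_add, coeff_mul_X_eq_zero hv, add_zero,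
      prod_X_eq_monomial, coeff_mul_monomial', mul_one]
    split_ifs with hle
    · rw [hg (v - squarefreeExponent (Finset.univ.erase i)) i (by simp [hv]),
        tsub_add_cancel_of_le hle, sub_self]
    · obtain ⟨j, hj⟩ : ∃ j, ¬ squarefreeExponent (Finset.univ.erase i) j ≤ v j := by
        simpa [Finsupp.le_def] using hle
      have hij : i ≠ j := by
        rintro rfl
        simp [squarefreeExponent_apply] at hj
      have hvj : v j = 0 := by
        simp [squarefreeExponent_apply, hij.symm] at hj
        exact hj
      rw [(h i j hij v hv hvj).1, sub_zero]
  obtain ⟨b, hb⟩ := Ideal.mem_span_singleton'.mp hmem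
  exact Ideal.mem_span_pair.mpr ⟨g, b, by rw [hb]; ring⟩

end CoefficientConditions

/-- The primary decomposition identity
`⟨e_{n−1}(x), e_{n−1}(x²)⟩ = ⟨e_{n−1}(x), e_{n−2}(x)⟩ ∩ ⋂_{i<j} ⟨xᵢ², xᵢ + xⱼ⟩`
in `ℂ[x₁,…,xₙ]`. -/
theorem stmt_18 (n : ℕ) (hn : 2 ≤ n) :
    Ideal.span {esymm (Fin n) ℂ (n - 1),
        aeval (fun i : Fin n => (X i : MvPolynomial (Fin n) ℂ) ^ 2) (esymm (Fin n) ℂ (n - 1))} =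
      Ideal.span {esymm (Fin n) ℂ (n - 1), esymm (Fin n) ℂ (n - 2)} ⊓
        ⨅ p ∈ {q : Fin n × Fin n | q.1 < q.2},
          Ideal.span {(X p.1 : MvPolynomial (Fin n) ℂ) ^ 2, X p.1 + X p.2} := by
  set J : Fin n → Fin n → Ideal (MvPolynomial (Fin n) ℂ) := fun i j =>
    Ideal.span {(X i : MvPolynomial (Fin n) ℂ) ^ 2, X i + X j}
  have hsq := aeval_sq_esymm_card_sub_one (σ := Fin n) (R := ℂ) (by simpa using hn)
  have hpair := @mem_span_esymm_prod_X_of_pairCoeffCondition (Fin n) ℂ _ _ _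
  have hadd (i j : Fin n) :
      Ideal.Quotient.mk (J i j) (X i) + Ideal.Quotient.mk (J i j) (X j) = 0 := by
    rw [← map_add]
    exact Ideal.Quotient.eq_zero_iff_mem.mpr (Ideal.subset_span (by simp))
  have hmul (i j : Fin n) :
      Ideal.Quotient.mk (J i j) (X i) * Ideal.Quotient.mk (J i j) (X j) = 0 := by
    have : Ideal.Quotient.mk (J i j) (X i ^ 2) = 0 :=
      Ideal.Quotient.eq_zero_iff_mem.mpr (Ideal.subset_span (by simp))
    rw [map_pow] at this
    linear_combination Ideal.Quotient.mk (J i j) (X i) * hadd i j - this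
  have hS (i j : Fin n) (hij : i ≠ j) := Ideal.Quotient.eq_zero_iff_mem.mp
    (map_esymm_card_sub_one_of_pair _ hij (hmul i j) (hadd i j))
  have hQ (i j : Fin n) (hij : i ≠ j) := Ideal.Quotient.eq.mp
    (map_esymm_card_sub_two_of_pair _ hij (hmul i j) (hadd i j))
  simp only [Fintype.card_fin] at hsq hpair hS hQ
  have hP (i j : Fin n) (hij : i ≠ j) : ∏ k, X k ∈ J i j := by
    rw [← Finset.mul_prod_erase _ _ (Finset.mem_univ i),
      ← Finset.mul_prod_erase _ _ (Finset.mem_erase.mpr ⟨hij.symm, Finset.mem_univ j⟩),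
      ← mul_assoc]
    refine Ideal.mul_mem_right _ _ (Ideal.Quotient.eq_zero_iff_mem.mp ?_)
    rw [map_mul, hmul]
  have hhalf : (C (2⁻¹ : ℂ) : MvPolynomial (Fin n) ℂ) * 2 = 1 := by
    rw [show (2 : MvPolynomial (Fin n) ℂ) = C 2 from (map_ofNat C 2).symm, ← C_mul]
    simp
  rw [hsq]
  set S := esymm (Fin n) ℂ (n - 1)
  set Q := esymm (Fin n) ℂ (n - 2)
  set P : MvPolynomial (Fin n) ℂ := ∏ k, X k
  apply le_antisymm
  · rw [Ideal.span_le]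
    have hSmem : S ∈ Ideal.span {S, Q} ⊓ ⨅ p ∈ {q : Fin n × Fin n | q.1 < q.2}, J p.1 p.2 := by
      simp only [Ideal.mem_inf, Ideal.mem_iInf]
      exact ⟨Ideal.subset_span (by simp), fun p hp => hS _ _ (ne_of_lt hp)⟩
    have hPQmem : P * Q ∈
        Ideal.span {S, Q} ⊓ ⨅ p ∈ {q : Fin n × Fin n | q.1 < q.2}, J p.1 p.2 := by
      simp only [Ideal.mem_inf, Ideal.mem_iInf]
      exact ⟨Ideal.mul_mem_left _ _ (Ideal.subset_span (by simp)),
        fun p hp => Ideal.mul_mem_right _ _ (hP _ _ (ne_of_lt hp))⟩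
    rintro _ (rfl | rfl)
    · exact hSmem
    · exact sub_mem (Ideal.pow_mem_of_mem _ hSmem 2 two_pos) (Ideal.mul_mem_left _ _ hPQmem)
  · intro f hf
    simp only [Ideal.mem_inf, Ideal.mem_iInf] at hf
    obtain ⟨hf, hfJ⟩ := hf
    obtain ⟨a, b, rfl⟩ := Ideal.mem_span_pair.mp hf
    have hb : ∀ i j, i < j → PairCoeffCondition i j b := by
      intro i j hij
      have hbQ : b * Q ∈ J i j :=
        (Ideal.add_mem_iff_right _ (Ideal.mul_mem_left _ a (hS i j hij.ne))).mp (hfJ (i, j) hij)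
      have hbR : b * ∏ k ∈ (Finset.univ.erase i).erase j, X k ∈ J i j := by
        have := sub_mem hbQ (Ideal.mul_mem_left _ b (hQ i j hij.ne))
        rwa [← mul_sub, sub_sub_cancel] at this
      rw [prod_X_eq_monomial] at hbR
      exact (pairCoeffCondition_of_mem hij.ne hbR).of_mul_monomial
        (by simp [squarefreeExponent_apply]) (by simp [squarefreeExponent_apply])
    obtain ⟨c, d, rfl⟩ := Ideal.mem_span_pair.mp <| hpair (f := b) fun i j hij =>
      hij.lt_or_gt.elim (hb i j) fun hji => (hb j i hji).symm
    refine Ideal.mem_span_pair.mpr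
      ⟨a + c * Q + C 2⁻¹ * d * S, -(C 2⁻¹ * d), ?_⟩
    linear_combination (d * P * Q) * hhalf
end

section
/- Let g ∈ ℂ[z_1,z_2] be a nonzero polynomial of total degree m ≥ 1 and let g_m be its homogeneous component of degree m (its initial form with respect to highest total degree). Let u = (u_1,u_2) ∈ ℂ² with u_1 ≠ 0, u_2 ≠ 0 and g_m(u_1,u_2) = 0. Then there exist ε_0 > 0 and a function v : (0,ε_0) → ℂ² such that g(v(ε)) = 0 for all ε ∈ (0,ε_0) and ε·v(ε) → (u_1,u_2) as ε → 0⁺. (This is the functional content of the Newton–Puiseux lifting lemma: any nonzero root of the top-degree form of g in the torus is the limit direction of a curve of actual solutions of g going to infinity, of the form v_i(ε) = u_i/ε + higher-order terms.) -/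
open MvPolynomial

namespace NewtonPuiseux

theorem eval_homogeneousComponent {σ R : Type*} [Fintype σ] [CommSemiring R]
    (g : MvPolynomial σ R) (n : ℕ) (x : σ → R) :
    eval x (homogeneousComponent n g) =
      ∑ s ∈ g.support, if s.degree = n then g.coeff s * ∏ i, x i ^ s i else 0 := by
  rw [homogeneousComponent_apply, map_sum, Finset.sum_filter]
  refine Finset.sum_congr rfl fun s _ => ?_
  rw [eval_monomial, Finsupp.prod_fintype _ _ fun i => pow_zero _]

theorem degree_le_totalDegree {σ R : Type*} [CommSemiring R] {g : MvPolynomial σ R}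
    {s : σ →₀ ℕ} (hs : s ∈ g.support) : s.degree ≤ g.totalDegree :=
  le_totalDegree hs

theorem homogeneousComponent_totalDegree_ne_zero {σ R : Type*} [CommSemiring R]
    {g : MvPolynomial σ R} (hg : g ≠ 0) : homogeneousComponent g.totalDegree g ≠ 0 := by
  obtain ⟨s, hs, hmax⟩ := Finset.exists_mem_eq_sup g.support (support_nonempty.mpr hg)
    fun s => s.sum fun _ e => e
  have hdeg : s.degree = g.totalDegree := hmax.symm
  intro h
  have hcoeff := congrArg (coeff s) h
  rw [coeff_homogeneousComponent, if_pos hdeg, coeff_zero] at hcoeff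
  exact mem_support_iff.mp hs hcoeff

/-- The univariate polynomial `t ↦ g (x + t • d)`. -/
noncomputable def restrictLine {σ R : Type*} [CommSemiring R] (g : MvPolynomial σ R)
    (x d : σ → R) : Polynomial R :=
  g.eval₂ Polynomial.C fun i => Polynomial.C (d i) * Polynomial.X + Polynomial.C (x i)

section restrictLine

variable {σ R : Type*} [CommSemiring R]

theorem eval_restrictLine (g : MvPolynomial σ R) (x d : σ → R) (t : R) :
    (restrictLine g x d).eval t = eval (fun i => d i * t + x i) g := by
  rw [restrictLine, ← Polynomial.coe_evalRingHom, hom_eval₂, eval, coe_eval₂Hom]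
  congr 1
  · ext; simp
  · ext; simp

theorem natDegree_coeff_prod_line (x d : σ → R) (s : σ → ℕ) (S : Finset σ) :
    (∏ i ∈ S, (Polynomial.C (d i) * Polynomial.X + Polynomial.C (x i)) ^ s i).natDegree
        ≤ ∑ i ∈ S, s i ∧
      (∏ i ∈ S, (Polynomial.C (d i) * Polynomial.X + Polynomial.C (x i)) ^ s i).coeff
        (∑ i ∈ S, s i) = ∏ i ∈ S, d i ^ s i := by
  classical
  induction S using Finset.induction_on with
  | empty => simp
  | insert a S ha ih =>
    have hlin : (Polynomial.C (d a) * Polynomial.X + Polynomial.C (x a)).natDegree ≤ 1 :=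
      Polynomial.natDegree_linear_le
    have hpow := Polynomial.natDegree_pow_le_of_le (s a) hlin
    have hcoeff := Polynomial.coeff_pow_of_natDegree_le (m := s a) hlin
    rw [mul_one] at hpow
    rw [mul_one] at hcoeff
    rw [Finset.prod_insert ha, Finset.sum_insert ha, Finset.prod_insert ha]
    refine ⟨Polynomial.natDegree_mul_le_of_le hpow ih.1, ?_⟩
    rw [Polynomial.coeff_mul_add_eq_of_natDegree_le hpow ih.1, ih.2, hcoeff]
    simp

variable [Fintype σ]

theorem natDegree_restrictLine_le (g : MvPolynomial σ R) (x d : σ → R) :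
    (restrictLine g x d).natDegree ≤ g.totalDegree := by
  rw [restrictLine, eval₂_eq']
  refine Polynomial.natDegree_sum_le_of_forall_le _ _ fun s hs => ?_
  refine (Polynomial.natDegree_C_mul_le _ _).trans ?_
  refine (natDegree_coeff_prod_line x d s _).1.trans ?_
  rw [← Finsupp.degree_eq_sum]
  exact degree_le_totalDegree hs

theorem coeff_restrictLine_totalDegree (g : MvPolynomial σ R) (x d : σ → R) :
    (restrictLine g x d).coeff g.totalDegree =
      eval d (homogeneousComponent g.totalDegree g) := by
  rw [restrictLine, eval₂_eq', eval_homogeneousComponent, Polynomial.finsetSum_coeff]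
  refine Finset.sum_congr rfl fun s hs => ?_
  obtain ⟨hdeg, hcoeff⟩ := natDegree_coeff_prod_line x d s Finset.univ
  rw [← Finsupp.degree_eq_sum] at hdeg hcoeff
  rw [Polynomial.coeff_C_mul]
  split_ifs with h
  · rw [← h, hcoeff]
  · rw [Polynomial.coeff_eq_zero_of_natDegree_lt
      (hdeg.trans_lt (lt_of_le_of_ne (degree_le_totalDegree hs) h)), mul_zero]

end restrictLine

theorem exists_mem_pow_card_le_norm_prod {K : Type*} [NormedField K] {s : Multiset K}
    (hs : s ≠ 0) : ∃ r ∈ s, ‖r‖ ^ s.card ≤ ‖s.prod‖ := by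
  classical
  obtain ⟨r, hr, hmin⟩ := s.toFinset.exists_min_image (fun z => ‖z‖)
    (Multiset.toFinset_nonempty.mpr hs)
  refine ⟨r, Multiset.mem_toFinset.mp hr, ?_⟩
  have key : ∀ t : Multiset K, (∀ z ∈ t, ‖r‖ ≤ ‖z‖) → ‖r‖ ^ t.card ≤ ‖t.prod‖ := by
    intro t
    induction t using Multiset.induction_on with
    | empty => simp
    | cons a t ih =>
      intro h
      rw [Multiset.card_cons, Multiset.prod_cons, norm_mul, pow_succ']
      exact mul_le_mul (h a (Multiset.mem_cons_self a t))
        (ih fun z hz => h z (Multiset.mem_cons_of_mem hz)) (by positivity) (norm_nonneg _)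
  exact key s fun z hz => hmin z (Multiset.mem_toFinset.mpr hz)

/-- The smallest root of a complex polynomial is controlled by its value at zero. -/
theorem exists_root_norm_pow_le {p : Polynomial ℂ} (hp : p.natDegree ≠ 0) :
    ∃ r, p.eval r = 0 ∧ ‖p.leadingCoeff‖ * ‖r‖ ^ p.natDegree ≤ ‖p.eval 0‖ := by
  have hsplit := IsAlgClosed.splits p
  have hcard := hsplit.natDegree_eq_card_roots
  have hne : p.roots ≠ 0 := fun h => hp (by rw [hcard, h, Multiset.card_zero])
  obtain ⟨r, hr, hle⟩ := exists_mem_pow_card_le_norm_prod hne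
  refine ⟨r, (Polynomial.mem_roots'.mp hr).2, ?_⟩
  rw [← Polynomial.coeff_zero_eq_eval_zero, hsplit.coeff_zero_eq_leadingCoeff_mul_prod_roots,
    hcard]
  simpa [norm_mul] using mul_le_mul_of_nonneg_left hle (norm_nonneg p.leadingCoeff)

theorem tendsto_pow_mul_eval_div {σ : Type*} [Fintype σ] (g : MvPolynomial σ ℂ) (u : σ → ℂ) :
    Filter.Tendsto (fun ε : ℝ => (ε : ℂ) ^ g.totalDegree * eval (fun i => u i / ε) g)
      (nhdsWithin 0 (Set.Ioi 0)) (nhds (eval u (homogeneousComponent g.totalDegree g))) := by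
  let F : ℝ → ℂ := fun ε => ∑ s ∈ g.support,
    (ε : ℂ) ^ (g.totalDegree - s.degree) * (g.coeff s * ∏ i, u i ^ s i)
  have hF : Continuous F := by fun_prop
  have hF0 : F 0 = eval u (homogeneousComponent g.totalDegree g) := by
    rw [eval_homogeneousComponent]
    refine Finset.sum_congr rfl fun s hs => ?_
    have hle := degree_le_totalDegree hs
    split_ifs with h
    · simp [h]
    · have hsub : g.totalDegree - s.degree ≠ 0 := by omega
      simp [hsub]
  rw [← hF0]
  refine (hF.tendsto 0).mono_left nhdsWithin_le_nhds |>.congr' ?_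
  filter_upwards [self_mem_nhdsWithin] with ε hε
  have hε0 : (ε : ℂ) ≠ 0 := Complex.ofReal_ne_zero.mpr (ne_of_gt hε)
  rw [eval_eq', Finset.mul_sum]
  refine Finset.sum_congr rfl fun s hs => ?_
  have hpow : (ε : ℂ) ^ g.totalDegree =
      (ε : ℂ) ^ (g.totalDegree - s.degree) * (ε : ℂ) ^ s.degree := by
    rw [← pow_add, Nat.sub_add_cancel (degree_le_totalDegree hs)]
  simp only [div_pow]
  rw [Finset.prod_div_distrib, Finset.prod_pow_eq_pow_sum, ← Finsupp.degree_eq_sum, hpow]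
  field_simp

end NewtonPuiseux

open NewtonPuiseux

/-- Newton–Puiseux lifting: if `u` is a root, with nonzero coordinates, of the top-degree
form of a bivariate polynomial `g` of total degree `m ≥ 1`, then there is a curve
`v(ε) = u/ε + higher order terms`, defined for small `ε > 0`, of actual solutions of
`g = 0`; i.e. `g(v(ε)) = 0` and `ε·v(ε) → u` as `ε → 0⁺`. -/
theorem stmt_19 (g : MvPolynomial (Fin 2) ℂ) (m : ℕ) (hm : 1 ≤ m)
    (hg0 : g ≠ 0) (hg : g.totalDegree = m) (u : Fin 2 → ℂ)
    (hu : ∀ i, u i ≠ 0) (hroot : eval u (homogeneousComponent m g) = 0) :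
    ∃ ε₀ > (0 : ℝ), ∃ v : ℝ → (Fin 2 → ℂ),
      (∀ ε ∈ Set.Ioo (0 : ℝ) ε₀, eval (v ε) g = 0) ∧
      Filter.Tendsto (fun ε : ℝ => fun i : Fin 2 => (ε : ℂ) * v ε i)
        (nhdsWithin 0 (Set.Ioi 0)) (nhds u) := by
  subst hg
  obtain ⟨d, hd⟩ : ∃ d, eval d (homogeneousComponent g.totalDegree g) ≠ 0 := by
    by_contra! h
    exact homogeneousComponent_totalDegree_ne_zero hg0 (MvPolynomial.funext fun d => by simp [h d])
  set c := eval d (homogeneousComponent g.totalDegree g) with hc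
  have hline : ∀ x : Fin 2 → ℂ, ∃ t : ℂ, eval (fun i => d i * t + x i) g = 0 ∧
      ‖c‖ * ‖t‖ ^ g.totalDegree ≤ ‖eval x g‖ := by
    intro x
    have hcoeff := coeff_restrictLine_totalDegree g x d
    rw [← hc] at hcoeff
    have hdeg : (restrictLine g x d).natDegree = g.totalDegree :=
      Polynomial.natDegree_eq_of_le_of_coeff_ne_zero (natDegree_restrictLine_le g x d)
        (hcoeff ▸ hd)
    obtain ⟨t, ht, hle⟩ := exists_root_norm_pow_le (p := restrictLine g x d) (by omega)
    rw [Polynomial.leadingCoeff, hdeg, hcoeff, eval_restrictLine] at hle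
    rw [eval_restrictLine] at ht
    exact ⟨t, ht, by simpa using hle⟩
  choose t ht htle using hline
  let τ : ℝ → ℂ := fun ε => t fun i => u i / ε
  refine ⟨1, one_pos, fun ε i => d i * τ ε + u i / ε, fun ε _ => ht _, ?_⟩
  have hlim : Filter.Tendsto (fun ε : ℝ => (ε : ℂ) * τ ε) (nhdsWithin 0 (Set.Ioi 0))
      (nhds 0) := by
    have hpow : Filter.Tendsto (fun ε : ℝ => ((ε : ℂ) * τ ε) ^ g.totalDegree)
        (nhdsWithin 0 (Set.Ioi 0)) (nhds 0) := by
      have hsmall := (tendsto_pow_mul_eval_div g u).norm.div_const ‖c‖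
      rw [hroot, norm_zero, zero_div] at hsmall
      refine squeeze_zero_norm (fun ε => ?_) hsmall
      rw [le_div_iff₀ (norm_pos_iff.mpr hd), mul_pow, norm_mul, norm_mul, norm_pow (τ ε), mul_assoc,
        mul_comm _ ‖c‖]
      exact mul_le_mul_of_nonneg_left (htle _) (norm_nonneg _)
    have hm0 : (g.totalDegree : ℝ) ≠ 0 := by exact_mod_cast (by omega : g.totalDegree ≠ 0)
    rw [tendsto_zero_iff_norm_tendsto_zero] at hpow ⊢
    have hrpow := hpow.rpow_const (p := (g.totalDegree : ℝ)⁻¹) (Or.inr (by positivity))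
    rw [Real.zero_rpow (inv_ne_zero hm0)] at hrpow
    refine hrpow.congr fun ε => ?_
    rw [norm_pow, Real.pow_rpow_inv_natCast (norm_nonneg _) (by omega)]
  refine tendsto_pi_nhds.mpr fun i => ?_
  have hadd := (hlim.const_mul (d i)).add_const (u i)
  rw [mul_zero, zero_add] at hadd
  refine hadd.congr' ?_
  filter_upwards [self_mem_nhdsWithin] with ε hε
  have hε0 : (ε : ℂ) ≠ 0 := Complex.ofReal_ne_zero.mpr (ne_of_gt hε)
  field_simp
end
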